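/- Let K be a fractal square of order n with digit set D which is a dendrite and which is not a line segment (there exist no points a, b ∈ ℝ² with K equal to the closed segment [a,b]). Then the self-similar boundary ∂K is a finite set whose cardinality is 3, 4, or 6. -/

import Mathlib

open Set Pointwise

noncomputable section

/-- The canonical embedding of `ℤ × ℤ` into `ℝ × ℝ`. -/
def coeZ2 (d : ℤ × ℤ) : ℝ × ℝ := ((d.1 : ℝ), (d.2 : ℝ))

/-- The contraction similarity `x ↦ (x + d) / n` of the plane. -/
def pieceMap (n : ℕ) (d : ℤ × ℤ) (x : ℝ × ℝ) : ℝ × ℝ := (n : ℝ)⁻¹ • (x + coeZ2 d)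

/-- `K` is a fractal square of order `n` with digit set `D ⊆ {0,…,n-1}²`,
`1 < |D| < n²`: a nonempty compact set with `K = (K + D)/n`. -/
def IsFractalSquare (n : ℕ) (D : Set (ℤ × ℤ)) (K : Set (ℝ × ℝ)) : Prop :=
  2 ≤ n ∧ D ⊆ Set.Icc (0, 0) ((n : ℤ) - 1, (n : ℤ) - 1) ∧
  1 < Nat.card D ∧ Nat.card D < n ^ 2 ∧
  K.Nonempty ∧ IsCompact K ∧
  K = ⋃ d ∈ D, pieceMap n d '' K

/-- A dendrite: a nonempty compact, connected, locally connected (planar) set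
containing no subset homeomorphic to the circle. -/
def IsDendrite (K : Set (ℝ × ℝ)) : Prop :=
  K.Nonempty ∧ IsCompact K ∧ IsConnected K ∧ LocallyConnectedSpace K ∧
  ¬ ∃ S : Set (ℝ × ℝ), S ⊆ K ∧ Nonempty (S ≃ₜ Circle)

/-- `Dpow n D k` is the digit set `D^k = n^{k-1}·D + ⋯ + n·D + D` (with `D^0 = {0}`). -/
def Dpow (n : ℕ) (D : Set (ℤ × ℤ)) : ℕ → Set (ℤ × ℤ)
  | 0 => {(0, 0)}
  | k + 1 => Set.image2 (fun a b => (n : ℤ) • a + b) (Dpow n D k) D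

/-- The critical set: union of pairwise intersections of first-order pieces. -/
def criticalSet (n : ℕ) (D : Set (ℤ × ℤ)) (K : Set (ℝ × ℝ)) : Set (ℝ × ℝ) :=
  ⋃ d ∈ D, ⋃ d' ∈ D, ⋃ (_ : d ≠ d'), (pieceMap n d '' K) ∩ (pieceMap n d' '' K)

/-- The self-similar boundary `∂K = {x ∈ K : ∃ k ≥ 1, ∃ d ∈ D^k, (x + d)/n^k ∈ C}`. -/
def ssBoundary (n : ℕ) (D : Set (ℤ × ℤ)) (K : Set (ℝ × ℝ)) : Set (ℝ × ℝ) :=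
  {x ∈ K | ∃ k ≥ 1, ∃ d ∈ Dpow n D k, ((n : ℝ) ^ k)⁻¹ • (x + coeZ2 d) ∈ criticalSet n D K}

lemma greatest_of {S : Set ℝ} (hc : IsCompact S) (hn : S.Nonempty) : ∃ a ∈ S, ∀ x ∈ S, x ≤ a := by
  obtain ⟨a, ha⟩ := hc.exists_isGreatest hn
  exact ⟨a, ha.1, fun x hx => ha.2 hx⟩

lemma least_of {S : Set ℝ} (hc : IsCompact S) (hn : S.Nonempty) : ∃ a ∈ S, ∀ x ∈ S, a ≤ x := by
  obtain ⟨a, ha⟩ := hc.exists_isLeast hn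
  exact ⟨a, ha.1, fun x hx => ha.2 hx⟩

/-- The closed sets all of whose gaps have equal `f`-values at both ends. -/
def GapSets {X : Type*} (f : ℝ → X) : Set (Set ℝ) :=
  {C | IsClosed C ∧ C ⊆ Icc 0 1 ∧ (0:ℝ) ∈ C ∧ (1:ℝ) ∈ C ∧
    ∀ a ∈ C, ∀ b ∈ C, a < b → (∀ c ∈ C, ¬ (a < c ∧ c < b)) → f a = f b}

lemma gapSets_minimal {X : Type*} [MetricSpace X] (f : ℝ → X) (hf : Continuous f) :
    ∃ C, Minimal (· ∈ GapSets f) C := by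
  apply zorn_superset
  intro c hcS hch
  rcases c.eq_empty_or_nonempty with rfl | hne
  · refine ⟨Icc 0 1, ⟨isClosed_Icc, le_rfl, by simp, by simp, ?_⟩, by simp⟩
    intro a ha b hb hab h
    exfalso
    exact h ((a+b)/2) ⟨by linarith [ha.1], by linarith [hb.2]⟩ ⟨by linarith, by linarith⟩
  refine ⟨⋂₀ c, ⟨isClosed_sInter fun s hs => (hcS hs).1, ?_, ?_, ?_, ?_⟩,
    fun s hs => sInter_subset_of_mem hs⟩
  · obtain ⟨s, hs⟩ := hne
    exact (sInter_subset_of_mem hs).trans (hcS hs).2.1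
  · exact fun s hs => (hcS hs).2.2.1
  · exact fun s hs => (hcS hs).2.2.2.1
  intro a ha b hb hab hgap
  -- approximate
  have key : ∀ ε > 0, ε < (b - a)/2 → ∃ a' b', a ≤ a' ∧ a' ≤ a + ε ∧ b - ε ≤ b' ∧ b' ≤ b ∧
      f a' = f b' := by
    intro ε hε hε2
    have : ∃ s ∈ c, Icc (a+ε) (b-ε) ∩ s = ∅ := by
      by_contra hcon
      push Not at hcon
      have : Nonempty c := hne.to_subtype
      have := IsCompact.nonempty_iInter_of_directed_nonempty_isCompact_isClosed
        (fun s : c => Icc (a+ε) (b-ε) ∩ (s : Set ℝ)) ?_ (fun s => hcon s s.2)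
        (fun s => isCompact_Icc.inter_right (hcS s.2).1)
        (fun s => isClosed_Icc.inter (hcS s.2).1)
      · obtain ⟨x, hx⟩ := this
        simp only [mem_iInter] at hx
        have hx0 := (hx (Classical.arbitrary c)).1
        refine hgap x (fun s hs => (hx ⟨s, hs⟩).2) ⟨?_, ?_⟩
        · linarith [hx0.1]
        · linarith [hx0.2]
      · intro s t
        rcases hch.total s.2 t.2 with h | h
        · exact ⟨s, le_rfl, inter_subset_inter_right _ h⟩
        · exact ⟨t, inter_subset_inter_right _ h, le_rfl⟩
    obtain ⟨s, hs, hemp⟩ := this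
    obtain ⟨hcl, hsub, -, -, hg⟩ := hcS hs
    obtain ⟨a', ha', ha'm⟩ := greatest_of (isCompact_Icc.inter_right hcl : IsCompact (Icc a (a+ε) ∩ s))
      ⟨a, ⟨le_rfl, by linarith⟩, ha s hs⟩
    obtain ⟨b', hb', hb'm⟩ := least_of (isCompact_Icc.inter_right hcl : IsCompact (Icc (b-ε) b ∩ s))
      ⟨b, ⟨by linarith, le_rfl⟩, hb s hs⟩
    refine ⟨a', b', ha'.1.1, ha'.1.2, hb'.1.1, hb'.1.2, hg a' ha'.2 b' hb'.2 ?_ ?_⟩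
    · linarith [ha'.1.2, hb'.1.1]
    · rintro x hx ⟨h1, h2⟩
      by_cases h3 : x ≤ a + ε
      · linarith [ha'm x ⟨⟨by linarith [ha'.1.1], h3⟩, hx⟩]
      by_cases h4 : b - ε ≤ x
      · linarith [hb'm x ⟨⟨h4, by linarith [hb'.1.2]⟩, hx⟩]
      have : x ∈ Icc (a+ε) (b-ε) ∩ s := ⟨⟨by linarith, by linarith⟩, hx⟩
      rw [hemp] at this
      exact this
  by_contra hne'
  have hd : 0 < dist (f a) (f b) := dist_pos.2 hne'
  obtain ⟨δ1, hδ1, h1⟩ := Metric.continuousAt_iff.1 (hf.continuousAt (x := a)) _ (half_pos hd)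
  obtain ⟨δ2, hδ2, h2⟩ := Metric.continuousAt_iff.1 (hf.continuousAt (x := b)) _ (half_pos hd)
  set ε := min (min δ1 δ2) ((b-a)/2) / 2 with hεdef
  have hm : 0 < min (min δ1 δ2) ((b-a)/2) := lt_min (lt_min hδ1 hδ2) (by linarith)
  have hm1 : min (min δ1 δ2) ((b-a)/2) ≤ δ1 := (min_le_left _ _).trans (min_le_left _ _)
  have hm2 : min (min δ1 δ2) ((b-a)/2) ≤ δ2 := (min_le_left _ _).trans (min_le_right _ _)
  have hm3 : min (min δ1 δ2) ((b-a)/2) ≤ (b-a)/2 := min_le_right _ _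
  obtain ⟨a', b', e1, e2, e3, e4, e5⟩ := key ε (by linarith) (by linarith)
  have h1' := h1 (x := a') (by rw [Real.dist_eq, abs_lt]; constructor <;> linarith)
  have h2' := h2 (x := b') (by rw [Real.dist_eq, abs_lt]; constructor <;> linarith)
  have := dist_triangle_left (f a) (f b) (f a')
  rw [e5] at this h1'
  linarith

lemma gapSets_good {X : Type*} [MetricSpace X] (f : ℝ → X) (hf : Continuous f) :
    ∃ C ∈ GapSets f, ∀ a ∈ C, ∀ b ∈ C, a < b → f a = f b → ∀ c ∈ C, ¬ (a < c ∧ c < b) := by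
  obtain ⟨C, hC⟩ := gapSets_minimal f hf
  refine ⟨C, hC.1, fun a ha b hb hab hfab c hc hc' => ?_⟩
  obtain ⟨hcl, hsub, h0, h1, hg⟩ := hC.1
  have hmem : C \ Ioo a b ∈ GapSets f := by
    refine ⟨hcl.sdiff isOpen_Ioo, sdiff_subset.trans hsub, ⟨h0, fun h => ?_⟩, ⟨h1, fun h => ?_⟩, ?_⟩
    · linarith [h.1, (hsub ha).1]
    · linarith [h.2, (hsub hb).2]
    intro x hx y hy hxy hgap
    by_cases hG : ∀ c ∈ C, ¬ (x < c ∧ c < y)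
    · exact hg x hx.1 y hy.1 hxy hG
    push Not at hG
    obtain ⟨z, hz, hxz, hzy⟩ := hG
    have hzI : z ∈ Ioo a b := by
      by_contra h
      exact hgap z ⟨hz, h⟩ ⟨hxz, hzy⟩
    have hxa : x = a := by
      have h1 : x ≤ a := by
        by_contra h
        exact hx.2 ⟨by linarith, by linarith [hzI.2]⟩
      by_contra hne
      exact hgap a ⟨ha, fun h => lt_irrefl _ h.1⟩ ⟨lt_of_le_of_ne h1 hne, by linarith [hzI.1]⟩
    have hyb : y = b := by
      have h1 : b ≤ y := by
        by_contra h
        exact hy.2 ⟨by linarith [hzI.1], by linarith⟩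
      by_contra hne
      exact hgap b ⟨hb, fun h => lt_irrefl _ h.2⟩ ⟨by linarith [hzI.2], lt_of_le_of_ne h1 (Ne.symm hne)⟩
    rw [hxa, hyb, hfab]
  have := hC.2 hmem sdiff_subset hc
  exact this.2 hc'

lemma infDist_cont {X : Type*} [MetricSpace X] (f : ℝ → X) (hf : Continuous f) (C : Set ℝ)
    (hC : C ⊆ Icc 0 1) (h0 : (0:ℝ) ∈ C) (y : X) :
    ContinuousOn (fun t => Metric.infDist y (f '' (C ∩ Iic t))) C := by
  have hne : ∀ t ∈ C, (f '' (C ∩ Iic t)).Nonempty := fun t ht => ⟨f 0, 0, ⟨h0, (hC ht).1⟩, rfl⟩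
  have hanti : ∀ s ∈ C, ∀ t, s ≤ t → Metric.infDist y (f '' (C ∩ Iic t)) ≤
      Metric.infDist y (f '' (C ∩ Iic s)) := fun s hs t hst =>
    Metric.infDist_le_infDist_of_subset
      (image_mono (inter_subset_inter_right _ (Iic_subset_Iic.2 hst))) (hne s hs)
  intro t ht
  rw [Metric.continuousWithinAt_iff]
  intro ε hε
  obtain ⟨δ, hδ, h⟩ := Metric.continuousAt_iff.1 (hf.continuousAt (x := t)) (ε/4) (by linarith)
  refine ⟨δ, hδ, fun {s} hs hst => ?_⟩
  -- key estimate
  have key : ∀ u ∈ C, ∀ v ∈ C, u ≤ v → dist u t < δ → dist v t < δ →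
      Metric.infDist y (f '' (C ∩ Iic u)) ≤ Metric.infDist y (f '' (C ∩ Iic v)) + ε/2 := by
    intro u hu v hv huv hut hvt
    refine le_of_forall_pos_lt_add fun η hη => ?_
    obtain ⟨z, ⟨w, ⟨hwC, hwv⟩, rfl⟩, hz⟩ := (Metric.infDist_lt_iff (hne v hv)).1
      (show Metric.infDist y (f '' (C ∩ Iic v)) < Metric.infDist y (f '' (C ∩ Iic v)) + η by linarith)
    by_cases hwu : w ≤ u
    · have := Metric.infDist_le_dist_of_mem (x := y) (mem_image_of_mem f (show w ∈ C ∩ Iic u from ⟨hwC, hwu⟩))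
      linarith
    · have hwt : dist w t < δ := by
        rw [Real.dist_eq, abs_lt] at *
        simp only [mem_Iic] at hwv
        constructor <;> linarith
      have := Metric.infDist_le_dist_of_mem (x := y) (mem_image_of_mem f (show u ∈ C ∩ Iic u from ⟨hu, le_refl u⟩))
      have h1 := h hwt
      have h2 := h hut
      have h3 := dist_triangle y (f w) (f u)
      have h4 := dist_triangle_right (f w) (f u) (f t)
      linarith
  rw [Real.dist_eq, abs_lt]
  rcases le_total s t with hle | hle
  · have := key s hs t ht hle hst (by simpa using hδ)
    have := hanti s hs t hle
    constructor <;> linarith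
  · have := key t ht s hs hle (by simpa using hδ) hst
    have := hanti t ht s hle
    constructor <;> linarith

lemma exists_phi {X : Type*} [MetricSpace X] [TopologicalSpace.SeparableSpace X]
    (f : ℝ → X) (hf : Continuous f) (C : Set ℝ) (hcl : IsClosed C)
    (hC : C ⊆ Icc 0 1) (h0 : (0:ℝ) ∈ C)
    (hg : ∀ a ∈ C, ∀ b ∈ C, a < b → f a = f b → ∀ c ∈ C, ¬ (a < c ∧ c < b)) :
    ∃ φ : ℝ → ℝ, ContinuousOn φ C ∧ MonotoneOn φ C ∧
      (∀ s ∈ C, ∀ t ∈ C, φ s = φ t ↔ f s = f t) := by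
  have : Nonempty X := ⟨f 0⟩
  let y := TopologicalSpace.denseSeq X
  have hy : DenseRange y := TopologicalSpace.denseRange_denseSeq X
  let m : ℕ → ℝ → ℝ := fun i t => Metric.infDist (y i) (f '' (C ∩ Iic t))
  let τ : ℕ → ℝ → ℝ := fun i t => (1/2)^i * (- min 1 (m i t))
  have hm0 : ∀ i t, 0 ≤ m i t := fun i t => Metric.infDist_nonneg
  have hne : ∀ t ∈ C, (f '' (C ∩ Iic t)).Nonempty := fun t ht => ⟨f 0, 0, ⟨h0, (hC ht).1⟩, rfl⟩
  have hbd : ∀ i t, ‖τ i t‖ ≤ (1/2)^i := by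
    intro i t
    have : |min 1 (m i t)| ≤ 1 := by
      rw [abs_le]; constructor
      · linarith [le_min zero_le_one (hm0 i t)]
      · exact min_le_left _ _
    simp only [τ, norm_mul, norm_neg, Real.norm_eq_abs]
    rw [abs_of_pos (by positivity : (0:ℝ) < (1/2)^i)]
    exact mul_le_of_le_one_right (by positivity) this
  have hsum : ∀ t, Summable (fun i => τ i t) := fun t =>
    Summable.of_norm_bounded summable_geometric_two (fun i => hbd i t)
  have hmono : ∀ i, ∀ s ∈ C, ∀ t, s ≤ t → τ i s ≤ τ i t := by
    intro i s hs t hst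
    have : m i t ≤ m i s := Metric.infDist_le_infDist_of_subset
      (image_mono (inter_subset_inter_right _ (Iic_subset_Iic.2 hst))) (hne s hs)
    have := min_le_min_left 1 this
    exact mul_le_mul_of_nonneg_left (by linarith) (by positivity)
  have hmonoφ : MonotoneOn (fun t => ∑' i, τ i t) C := fun s hs t ht hst =>
    Summable.tsum_le_tsum (fun i => hmono i s hs t hst) (hsum s) (hsum t)
  have haux : ∀ s ∈ C, ∀ t ∈ C, s < t → ((∑' i, τ i s) = (∑' i, τ i t) ↔ f s = f t) := by
    intro s hs t ht hst
    constructor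
    · intro heq
      by_contra hne'
      have hnot : f t ∉ f '' (C ∩ Iic s) := by
        rintro ⟨u, ⟨huC, hus⟩, hu⟩
        rcases eq_or_lt_of_le (show u ≤ s from hus) with rfl | hlt
        · exact hne' hu
        · exact hg u huC t ht (hlt.trans hst) hu s hs ⟨hlt, hst⟩
      have hcomp : IsCompact (f '' (C ∩ Iic s)) := by
        have : IsCompact C := isCompact_Icc.of_isClosed_subset hcl hC
        exact (this.inter_right isClosed_Iic).image hf
      have hpos : 0 < Metric.infDist (f t) (f '' (C ∩ Iic s)) :=
        (hcomp.isClosed.notMem_iff_infDist_pos (hne s hs)).1 hnot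
      set ε := min 1 (Metric.infDist (f t) (f '' (C ∩ Iic s))) with hε
      have hεpos : 0 < ε := lt_min one_pos hpos
      obtain ⟨i, hi⟩ := hy.exists_dist_lt (f t) (half_pos hεpos)
      have h1 : m i t ≤ dist (f t) (y i) := by
        rw [dist_comm]
        exact Metric.infDist_le_dist_of_mem (mem_image_of_mem f ⟨ht, le_refl t⟩)
      have h2 : ε ≤ m i s + dist (f t) (y i) :=
        (min_le_right _ _).trans Metric.infDist_le_infDist_add_dist
      have hε1 : ε ≤ 1 := min_le_left _ _
      have h3 : min 1 (m i t) < min 1 (m i s) := by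
        refine lt_min ?_ ?_
        · exact lt_of_le_of_lt (min_le_right _ _) (by linarith)
        · exact lt_of_le_of_lt (min_le_right _ _) (by linarith)
      have h4 : τ i s < τ i t := mul_lt_mul_of_pos_left (by linarith) (by positivity)
      have := Summable.tsum_lt_tsum (fun j => hmono j s hs t hst.le) h4 (hsum s) (hsum t)
      linarith
    · intro heq
      have : f '' (C ∩ Iic s) = f '' (C ∩ Iic t) := by
        apply Subset.antisymm
        · exact image_mono (inter_subset_inter_right _ (Iic_subset_Iic.2 hst.le))
        · rintro _ ⟨u, ⟨huC, hut⟩, rfl⟩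
          by_cases hus : u ≤ s
          · exact ⟨u, ⟨huC, hus⟩, rfl⟩
          · rcases eq_or_lt_of_le (show u ≤ t from hut) with rfl | hlt
            · exact ⟨s, ⟨hs, le_refl s⟩, heq⟩
            · exact absurd ⟨not_le.1 hus, hlt⟩ (hg s hs t ht hst heq u huC)
      simp only [τ, m, this]
  refine ⟨fun t => ∑' i, τ i t, ?_, hmonoφ, ?_⟩
  · refine continuousOn_tsum (fun i => ?_) summable_geometric_two (fun i t _ => hbd i t)
    exact continuousOn_const.mul ((continuousOn_const.inf (infDist_cont f hf C hC h0 (y i))).neg)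
  · intro s hs t ht
    rcases lt_trichotomy s t with h | rfl | h
    · exact haux s hs t ht h
    · simp
    · have := haux t ht s hs h
      constructor
      · intro h'; exact (this.1 h'.symm).symm
      · intro h'; exact (this.2 h'.symm).symm

lemma exists_arc {X : Type*} [MetricSpace X] [TopologicalSpace.SeparableSpace X]
    (f : ℝ → X) (hf : Continuous f) (h01 : f 0 ≠ f 1) :
    ∃ g : ℝ → X, ContinuousOn g (Icc 0 1) ∧ InjOn g (Icc 0 1) ∧ g 0 = f 0 ∧ g 1 = f 1 ∧
      ∀ t ∈ Icc (0:ℝ) 1, g t ∈ f '' Icc 0 1 := by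
  obtain ⟨C, ⟨hcl, hC, h0, h1, hgap⟩, hg⟩ := gapSets_good f hf
  obtain ⟨φ, hφc, hφm, hφ⟩ := exists_phi f hf C hcl hC h0 hg
  have hCc : IsCompact C := isCompact_Icc.of_isClosed_subset hcl hC
  have hlt : φ 0 < φ 1 := lt_of_le_of_ne (hφm h0 h1 zero_le_one) (fun h => h01 ((hφ 0 h0 1 h1).1 h))
  have hsurj : ∀ w ∈ Icc (φ 0) (φ 1), ∃ t ∈ C, φ t = w := by
    intro w hw
    have hc1 : IsCompact (C ∩ φ ⁻¹' Iic w) :=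
      isCompact_Icc.of_isClosed_subset (hφc.preimage_isClosed_of_isClosed hcl isClosed_Iic)
        (inter_subset_left.trans hC)
    have hc2 : IsCompact (C ∩ φ ⁻¹' Ici w) :=
      isCompact_Icc.of_isClosed_subset (hφc.preimage_isClosed_of_isClosed hcl isClosed_Ici)
        (inter_subset_left.trans hC)
    obtain ⟨a, ha, ham⟩ := greatest_of hc1 ⟨0, h0, hw.1⟩
    obtain ⟨b, hb, hbm⟩ := least_of hc2 ⟨1, h1, hw.2⟩
    have ha2 : φ a ≤ w := ha.2
    have hb2 : w ≤ φ b := hb.2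
    rcases le_or_gt b a with h | h
    · exact ⟨b, hb.1, le_antisymm ((hφm hb.1 ha.1 h).trans ha2) hb2⟩
    · have hfab : f a = f b := by
        refine hgap a ha.1 b hb.1 h ?_
        rintro c hc ⟨hac, hcb⟩
        rcases le_total (φ c) w with h' | h'
        · linarith [ham c ⟨hc, h'⟩]
        · linarith [hbm c ⟨hc, h'⟩]
      have := (hφ a ha.1 b hb.1).2 hfab
      exact ⟨a, ha.1, by linarith⟩
  choose! σ hσC hσ using hsurj
  let ℓ : ℝ → ℝ := fun t => φ 0 + t * (φ 1 - φ 0)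
  have hℓ : ∀ t ∈ Icc (0:ℝ) 1, ℓ t ∈ Icc (φ 0) (φ 1) := by
    intro t ht
    simp only [ℓ]
    constructor
    · nlinarith [ht.1]
    · nlinarith [ht.2]
  have hgc : ContinuousOn (fun w => f (σ w)) (Icc (φ 0) (φ 1)) := by
    rw [continuousOn_iff_isClosed]
    intro A hA
    refine ⟨φ '' (C ∩ f ⁻¹' A), ?_, ?_⟩
    · exact ((hCc.inter_right (hA.preimage hf)).image_of_continuousOn
        (hφc.mono inter_subset_left)).isClosed
    · ext w
      constructor
      · rintro ⟨h, hw⟩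
        exact ⟨⟨σ w, ⟨hσC w hw, h⟩, hσ w hw⟩, hw⟩
      · rintro ⟨⟨t, ⟨htC, htA⟩, rfl⟩, hw⟩
        refine ⟨?_, hw⟩
        have := (hφ _ (hσC _ hw) t htC).1 (hσ _ hw)
        simp only [mem_preimage] at *
        rw [this]; exact htA
  refine ⟨fun t => f (σ (ℓ t)), ?_, ?_, ?_, ?_, ?_⟩
  · exact hgc.comp (by fun_prop) hℓ
  · intro s hs t ht hst
    have h := (hφ _ (hσC _ (hℓ s hs)) _ (hσC _ (hℓ t ht))).2 hst
    rw [hσ _ (hℓ s hs), hσ _ (hℓ t ht)] at h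
    simp only [ℓ] at h
    have : s * (φ 1 - φ 0) = t * (φ 1 - φ 0) := by linarith
    exact mul_right_cancel₀ (by linarith) this
  · have h := hℓ 0 (by simp)
    refine (hφ _ (hσC _ h) _ h0).1 ?_
    rw [hσ _ h]; simp [ℓ]
  · have h := hℓ 1 (by simp)
    refine (hφ _ (hσC _ h) _ h1).1 ?_
    rw [hσ _ h]; simp [ℓ]
  · intro t ht
    exact ⟨_, hC (hσC _ (hℓ t ht)), rfl⟩

/-- `S` contains no two arcs meeting exactly in their common end points. -/
def NoCirc (S : Set (ℝ × ℝ)) : Prop :=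
  ∀ g h : ℝ → ℝ × ℝ, ContinuousOn g (Icc 0 1) → ContinuousOn h (Icc 0 1) →
    InjOn g (Icc 0 1) → InjOn h (Icc 0 1) → g 0 = h 0 → g 1 = h 1 →
    (∀ t ∈ Icc (0:ℝ) 1, g t ∈ S) → (∀ t ∈ Icc (0:ℝ) 1, h t ∈ S) →
    (∀ s ∈ Ioo (0:ℝ) 1, ∀ t ∈ Icc (0:ℝ) 1, g s ≠ h t) → False

lemma NoCirc.mono {S T : Set (ℝ × ℝ)} (h : NoCirc T) (hST : S ⊆ T) : NoCirc S :=
  fun g k a1 a2 a3 a4 a5 a6 a7 a8 a9 => h g k a1 a2 a3 a4 a5 a6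
    (fun t ht => hST (a7 t ht)) (fun t ht => hST (a8 t ht)) a9

lemma NoCirc.of_image {S T : Set (ℝ × ℝ)} (h : NoCirc T) (F : ℝ × ℝ → ℝ × ℝ) (hF : Continuous F)
    (hinj : Function.Injective F) (hST : ∀ x ∈ S, F x ∈ T) : NoCirc S :=
  fun g k a1 a2 a3 a4 a5 a6 a7 a8 a9 => h (F ∘ g) (F ∘ k)
    (hF.comp_continuousOn a1) (hF.comp_continuousOn a2) (hinj.comp_injOn a3) (hinj.comp_injOn a4)
    (by simp [a5]) (by simp [a6])
    (fun t ht => hST _ (a7 t ht)) (fun t ht => hST _ (a8 t ht))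
    (fun s hs t ht e => a9 s hs t ht (hinj e))

lemma noCirc_of_no_circle (S : Set (ℝ × ℝ))
    (hS : ¬ ∃ T : Set (ℝ × ℝ), T ⊆ S ∧ Nonempty (T ≃ₜ Circle)) : NoCirc S := by
  intro g h hg hh ig ih h0 h1 gS hS' hdis
  apply hS
  let c : ℝ → ℝ × ℝ := fun t => if t ≤ 1 then g t else h (2 - t)
  have hc : ContinuousOn c (Icc 0 2) := by
    have e : Icc (0:ℝ) 2 = Icc 0 1 ∪ Icc 1 2 := by
      rw [Icc_union_Icc_eq_Icc] <;> norm_num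
    rw [e]
    apply ContinuousOn.union_of_isClosed _ _ isClosed_Icc isClosed_Icc
    · exact hg.congr fun t ht => by simp [c, ht.2]
    · have : ContinuousOn (fun t => h (2 - t)) (Icc 1 2) :=
        hh.comp (by fun_prop) (fun t ht => ⟨by linarith [ht.2], by linarith [ht.1]⟩)
      refine this.congr fun t ht => ?_
      simp only [c]
      split_ifs with h'
      · have : t = 1 := le_antisymm h' ht.1
        subst this
        rw [h1]; norm_num
      · rfl
  have hcS : ∀ t ∈ Icc (0:ℝ) 2, c t ∈ S := by
    intro t ht
    simp only [c]
    split_ifs with h'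
    · exact gS t ⟨ht.1, h'⟩
    · exact hS' _ ⟨by linarith [ht.2], by linarith⟩
  have key : ∀ s t : ℝ, 0 ≤ s → s ≤ 1 → 1 < t → t < 2 → g s ≠ h (2 - t) := by
    intro s t a1 a2 a3 a4 e
    rcases eq_or_lt_of_le a1 with rfl | a1
    · rw [h0] at e
      have := ih (by simp) ⟨by linarith, by linarith⟩ e
      linarith
    rcases eq_or_lt_of_le a2 with rfl | a2
    · rw [h1] at e
      have := ih (by simp) ⟨by linarith, by linarith⟩ e
      linarith
    exact hdis s ⟨a1, a2⟩ _ ⟨by linarith, by linarith⟩ e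
  have hci : InjOn c (Ico 0 2) := by
    intro s hs t ht e
    simp only [c] at e
    split_ifs at e with a b b
    · exact ig ⟨hs.1, a⟩ ⟨ht.1, b⟩ e
    · exact absurd e (key s t hs.1 a (not_le.1 b) ht.2)
    · exact absurd e.symm (key t s ht.1 b (not_le.1 a) hs.2)
    · have := ih ⟨by linarith [hs.2], by linarith⟩ ⟨by linarith [ht.2], by linarith⟩ e
      linarith
  have hfact : Fact ((0:ℝ) < 2) := ⟨by norm_num⟩
  let G : AddCircle (2:ℝ) → ℝ × ℝ := AddCircle.liftIco 2 0 c
  have hG : Continuous G := AddCircle.liftIco_zero_continuous (by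
    simp only [c]; norm_num; exact h0) hc
  have hGv : ∀ z : AddCircle (2:ℝ), ∃ t ∈ Ico (0:ℝ) 2, (t : AddCircle (2:ℝ)) = z ∧ G z = c t := by
    intro z
    obtain ⟨t, ht, rfl⟩ := (AddCircle.coe_image_Ico_eq (2:ℝ) 0).symm ▸ mem_univ z
    rw [zero_add] at ht
    exact ⟨t, ht, rfl, AddCircle.liftIco_zero_coe_apply ht⟩
  have hGi : Function.Injective G := by
    intro z w e
    obtain ⟨s, hs, rfl, es⟩ := hGv z
    obtain ⟨t, ht, rfl, et⟩ := hGv w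
    rw [es, et] at e
    rw [hci hs ht e]
  refine ⟨range G, ?_, ⟨?_⟩⟩
  · rintro _ ⟨z, rfl⟩
    obtain ⟨s, hs, rfl, es⟩ := hGv z
    rw [es]; exact hcS s ⟨hs.1, hs.2.le⟩
  · have := (hG.isClosedEmbedding hGi).isEmbedding.toHomeomorph
    exact this.symm.trans (AddCircle.homeomorphCircle (by norm_num))

lemma arc_sub (S : Set (ℝ × ℝ)) (hS : NoCirc S) (W : Set (ℝ × ℝ)) (hWS : W ⊆ S)
    (g : ℝ → ℝ × ℝ) (hg : ContinuousOn g (Icc 0 1)) (ig : InjOn g (Icc 0 1))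
    (gS : ∀ t ∈ Icc (0:ℝ) 1, g t ∈ S) (hW : JoinedIn W (g 0) (g 1)) :
    ∀ t ∈ Icc (0:ℝ) 1, g t ∈ W := by
  obtain ⟨γ, hγ⟩ := hW
  intro t0 ht0
  by_contra hnot
  have hrc : IsClosed (range γ) := (isCompact_range γ.continuous).isClosed
  have hrW : range γ ⊆ W := by rintro _ ⟨u, rfl⟩; exact hγ u
  have hB : IsClosed (Icc 0 1 ∩ g ⁻¹' (range γ)) := hg.preimage_isClosed_of_isClosed isClosed_Icc hrc
  have h0 : (0:ℝ) ∈ Icc (0:ℝ) 1 ∩ g ⁻¹' (range γ) := ⟨by simp, 0, by simp⟩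
  have h1 : (1:ℝ) ∈ Icc (0:ℝ) 1 ∩ g ⁻¹' (range γ) := ⟨by simp, 1, by simp⟩
  have hBc : IsCompact (Icc 0 1 ∩ g ⁻¹' (range γ)) :=
    isCompact_Icc.of_isClosed_subset hB inter_subset_left
  obtain ⟨a, ha, ham⟩ := greatest_of (hBc.inter_right (isClosed_Iic (a := t0))) ⟨0, h0, ht0.1⟩
  obtain ⟨b, hb, hbm⟩ := least_of (hBc.inter_right (isClosed_Ici (a := t0))) ⟨1, h1, ht0.2⟩
  have hat : a ≤ t0 := ha.2
  have htb : t0 ≤ b := hb.2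
  have hab : a < b := by
    rcases eq_or_lt_of_le (hat.trans htb) with h | h
    · exfalso
      have : t0 = a := by linarith
      rw [this] at hnot
      exact hnot (hrW ha.1.2)
    · exact h
  have hgap : ∀ s, a < s → s < b → g s ∉ range γ := by
    intro s h1 h2 h3
    have hs : s ∈ Icc (0:ℝ) 1 := ⟨by linarith [ha.1.1.1], by linarith [hb.1.1.2]⟩
    rcases le_total s t0 with h | h
    · linarith [ham s ⟨⟨hs, h3⟩, h⟩]
    · linarith [hbm s ⟨⟨hs, h3⟩, h⟩]
  obtain ⟨u, hu⟩ := ha.1.2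
  obtain ⟨v, hv⟩ := hb.1.2
  have hjoin : JoinedIn (range γ) (g a) (g b) := by
    have hI : PathConnectedSpace unitInterval :=
      isPathConnected_iff_pathConnectedSpace.1 ((convex_Icc (0:ℝ) 1).isPathConnected ⟨0, by simp⟩)
    have : IsPathConnected (range γ) := isPathConnected_range γ.continuous
    exact this.joinedIn _ ⟨u, hu⟩ _ ⟨v, hv⟩
  obtain ⟨δ, hδ⟩ := hjoin
  have hneq : g a ≠ g b := fun e => by
    have := ig ha.1.1 hb.1.1 e
    linarith
  obtain ⟨k, kc, ki, k0, k1, kr⟩ := exists_arc δ.extend δ.continuous_extend (by simpa using hneq)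
  have hkr : ∀ t ∈ Icc (0:ℝ) 1, k t ∈ range γ := by
    intro t ht
    obtain ⟨s, hs, e⟩ := kr t ht
    rw [← e, Path.extend_apply _ hs]
    exact hδ _
  rw [Path.extend_zero] at k0
  rw [Path.extend_one] at k1
  have hl : ∀ t ∈ Icc (0:ℝ) 1, a + t * (b - a) ∈ Icc (0:ℝ) 1 := by
    intro t ht
    have := ha.1.1.1
    have := hb.1.1.2
    constructor
    · nlinarith [ht.1]
    · nlinarith [ht.2]
  refine hS (fun t => g (a + t * (b - a))) k ?_ kc ?_ ki ?_ ?_ ?_ ?_ ?_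
  · exact hg.comp (by fun_prop) hl
  · intro s hs t ht e
    have := ig (hl s hs) (hl t ht) e
    have : s * (b - a) = t * (b - a) := by linarith
    exact mul_right_cancel₀ (by linarith) this
  · simp [k0]
  · simp [k1]
  · exact fun t ht => gS _ (hl t ht)
  · exact fun t ht => hWS (hrW (hkr t ht))
  · intro s hs t ht e
    refine hgap _ ?_ ?_ (e ▸ hkr t ht)
    · nlinarith [hs.1]
    · nlinarith [hs.2]

section
variable {n : ℕ} {D : Set (ℤ × ℤ)} {K : Set (ℝ × ℝ)}

/-- The hypotheses used in the proof. -/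
structure FS (n : ℕ) (D : Set (ℤ × ℤ)) (K : Set (ℝ × ℝ)) : Prop where
  hn : 2 ≤ n
  hD : ∀ d ∈ D, (0 ≤ d.1 ∧ d.1 ≤ n - 1) ∧ (0 ≤ d.2 ∧ d.2 ≤ n - 1)
  hne : K.Nonempty
  hcomp : IsCompact K
  hconn : IsPreconnected K
  hmem : ∀ x, x ∈ K ↔ ∃ d ∈ D, ∃ y ∈ K, pieceMap n d y = x
  hnoc : NoCirc K
  hfull : ∃ d : ℤ × ℤ, (0 ≤ d.1 ∧ d.1 ≤ n - 1) ∧ (0 ≤ d.2 ∧ d.2 ≤ n - 1) ∧ d ∉ D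


lemma pieceMap_cont (n : ℕ) (d : ℤ × ℤ) : Continuous (pieceMap n d) := by
  unfold pieceMap; fun_prop

lemma pieceMap_dist (n : ℕ) (d : ℤ × ℤ) (x y : ℝ × ℝ) :
    dist (pieceMap n d x) (pieceMap n d y) = (n:ℝ)⁻¹ * dist x y := by
  unfold pieceMap
  rw [dist_smul₀, dist_add_right]
  simp

namespace FS

lemma n2 (h : FS n D K) : (2:ℝ) ≤ n := by exact_mod_cast h.hn

lemma finD (h : FS n D K) : D.Finite :=
  (Set.finite_Icc ((0:ℤ),(0:ℤ)) ((n:ℤ)-1,(n:ℤ)-1)).subset fun d hd => by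
    have := h.hD d hd
    exact ⟨⟨this.1.1, this.2.1⟩, ⟨this.1.2, this.2.2⟩⟩

lemma conn (h : FS n D K) (D1 : Set (ℤ × ℤ)) (h1 : ∃ d ∈ D, d ∈ D1) (h2 : ∃ d ∈ D, d ∉ D1) :
    ∃ d ∈ D, d ∈ D1 ∧ ∃ d' ∈ D, d' ∉ D1 ∧ ∃ u ∈ K, ∃ v ∈ K, pieceMap n d u = pieceMap n d' v := by
  have hc := isPreconnected_closed_iff.1 h.hconn
  have cl : ∀ E : Set (ℤ × ℤ), E ⊆ D → IsClosed (⋃ d ∈ E, pieceMap n d '' K) := fun E hE =>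
    (h.finD.subset hE).isClosed_biUnion fun d _ => (h.hcomp.image (pieceMap_cont n d)).isClosed
  obtain ⟨p, hp⟩ := h.hne
  obtain ⟨d1, hd1, hd1'⟩ := h1
  obtain ⟨d2, hd2, hd2'⟩ := h2
  obtain ⟨x, -, hx1, hx2⟩ := hc (⋃ d ∈ (D ∩ D1), pieceMap n d '' K) (⋃ d ∈ (D \ D1), pieceMap n d '' K)
    (cl _ inter_subset_left) (cl _ sdiff_subset) (fun x hx => by
      obtain ⟨d, hd, y, hy, e⟩ := (h.hmem x).1 hx
      by_cases hdd : d ∈ D1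
      · left; exact mem_biUnion (show d ∈ D ∩ D1 from ⟨hd, hdd⟩) ⟨y, hy, e⟩
      · right; exact mem_biUnion (show d ∈ D \ D1 from ⟨hd, hdd⟩) ⟨y, hy, e⟩)
    ⟨pieceMap n d1 p, (h.hmem _).2 ⟨d1, hd1, p, hp, rfl⟩,
      mem_biUnion (show d1 ∈ D ∩ D1 from ⟨hd1, hd1'⟩) ⟨p, hp, rfl⟩⟩
    ⟨pieceMap n d2 p, (h.hmem _).2 ⟨d2, hd2, p, hp, rfl⟩,
      mem_biUnion (show d2 ∈ D \ D1 from ⟨hd2, hd2'⟩) ⟨p, hp, rfl⟩⟩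
  simp only [mem_iUnion] at hx1 hx2
  obtain ⟨d, hd, u, hu, e⟩ := hx1
  obtain ⟨d', hd', v, hv, e'⟩ := hx2
  exact ⟨d, hd.1, hd.2, d', hd'.1, hd'.2, u, hu, v, hv, e.trans e'.symm⟩

lemma unit (h : FS n D K) : ∀ x ∈ K, (0 ≤ x.1 ∧ x.1 ≤ 1) ∧ (0 ≤ x.2 ∧ x.2 ≤ 1) := by
  have n2 := h.n2
  have npos : (0:ℝ) < n := by linarith
  -- coordinates
  have aux : ∀ c : ℝ × ℝ → ℝ, Continuous c → (∀ x ∈ K, ∃ y ∈ K, ∃ d : ℝ, 0 ≤ d ∧ d ≤ n - 1 ∧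
      n * c x = c y + d) → ∀ x ∈ K, 0 ≤ c x ∧ c x ≤ 1 := by
    intro c hc hx x hxK
    obtain ⟨M, hM, hMm⟩ := h.hcomp.exists_isMaxOn h.hne hc.continuousOn
    obtain ⟨m, hm, hmm⟩ := h.hcomp.exists_isMinOn h.hne hc.continuousOn
    rw [isMaxOn_iff] at hMm
    rw [isMinOn_iff] at hmm
    obtain ⟨y, hy, d, d0, d1, e⟩ := hx M hM
    obtain ⟨y', hy', d', d0', d1', e'⟩ := hx m hm
    have a1 := hMm y hy
    have a2 := hmm y' hy'
    have a3 := hMm x hxK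
    have a4 := hmm x hxK
    constructor
    · by_contra hneg
      nlinarith
    · by_contra hneg
      nlinarith
  intro x hx
  refine ⟨aux (fun x => x.1) continuous_fst ?_ x hx, aux (fun x => x.2) continuous_snd ?_ x hx⟩
  · intro x hx
    obtain ⟨d, hd, y, hy, rfl⟩ := (h.hmem x).1 hx
    have := h.hD d hd
    refine ⟨y, hy, d.1, by exact_mod_cast this.1.1, by exact_mod_cast this.1.2, ?_⟩
    simp [pieceMap, coeZ2]; field_simp
  · intro x hx
    obtain ⟨d, hd, y, hy, rfl⟩ := (h.hmem x).1 hx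
    have := h.hD d hd
    refine ⟨y, hy, d.2, by exact_mod_cast this.2.1, by exact_mod_cast this.2.2, ?_⟩
    simp [pieceMap, coeZ2]; field_simp

end FS

/-- Chains of first-order pieces. -/
inductive PChain (n : ℕ) (D : Set (ℤ × ℤ)) (K : Set (ℝ × ℝ)) : ℝ × ℝ → ℝ × ℝ → Type
  | single (d : ℤ × ℤ) (hd : d ∈ D) (u v : ℝ × ℝ) (hu : u ∈ K) (hv : v ∈ K) :
      PChain n D K (pieceMap n d u) (pieceMap n d v)
  | trans (p q r : ℝ × ℝ) (a : PChain n D K p q) (b : PChain n D K q r) : PChain n D K p r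

/-- Substituting paths into a chain. -/
def PChain.path (Γ : ∀ u v : ℝ × ℝ, Path u v) : ∀ {p q : ℝ × ℝ}, PChain n D K p q → Path p q
  | _, _, .single d _ u v _ _ => (Γ u v).map (pieceMap_cont n d)
  | _, _, .trans _ _ _ a b => (PChain.path Γ a).trans (PChain.path Γ b)

lemma PChain.path_rel (R : ℝ × ℝ → ℝ × ℝ → Prop) (Γ Γ' : ∀ u v : ℝ × ℝ, Path u v)
    (hR : ∀ d ∈ D, ∀ u ∈ K, ∀ v ∈ K, ∀ t, R (pieceMap n d (Γ u v t)) (pieceMap n d (Γ' u v t)))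
    {p q : ℝ × ℝ} (c : PChain n D K p q) : ∀ t, R (c.path Γ t) (c.path Γ' t) := by
  induction c with
  | single d hd u v hu hv => intro t; exact hR d hd u hu v hv t
  | trans p q r a b iha ihb =>
    intro t
    simp only [PChain.path, Path.trans_apply]
    split_ifs
    · exact iha _
    · exact ihb _

namespace FS

lemma exists_chain (h : FS n D K) (p q : ℝ × ℝ) (hp : p ∈ K) (hq : q ∈ K) :
    Nonempty (PChain n D K p q) := by
  let D1 : Set (ℤ × ℤ) := {d | d ∈ D ∧ ∃ u ∈ K, Nonempty (PChain n D K p (pieceMap n d u))}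
  have hall : ∀ d ∈ D, d ∈ D1 := by
    by_contra hcon
    push Not at hcon
    obtain ⟨d0, hd0, u0, hu0, e0⟩ := (h.hmem p).1 hp
    obtain ⟨d, hd, ⟨-, u', hu', ⟨c⟩⟩, d', hd', hn', u, hu, v, hv, e⟩ := h.conn D1
      ⟨d0, hd0, hd0, u0, hu0, ⟨e0 ▸ PChain.single d0 hd0 u0 u0 hu0 hu0⟩⟩ hcon
    refine hn' ⟨hd', v, hv, ⟨?_⟩⟩
    rw [← e]
    exact .trans _ _ _ c (.single d hd u' u hu' hu)
  obtain ⟨d, hd, v, hv, rfl⟩ := (h.hmem q).1 hq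
  obtain ⟨-, u, hu, ⟨c⟩⟩ := hall d hd
  exact ⟨.trans _ _ _ c (.single d hd u v hu hv)⟩

end FS

/-- The straight path. -/
def linePath (p q : ℝ × ℝ) : Path p q where
  toFun t := AffineMap.lineMap p q (t : ℝ)
  continuous_toFun := by
    have : Continuous (AffineMap.lineMap p q : ℝ → ℝ × ℝ) := AffineMap.lineMap_continuous
    exact this.comp continuous_subtype_val
  source' := by simp
  target' := by simp

open Classical in
/-- Successive approximations of paths in `K`. -/
def approxPath (c : ∀ p q : ℝ × ℝ, p ∈ K → q ∈ K → PChain n D K p q) :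
    ℕ → ∀ u v : ℝ × ℝ, Path u v
  | 0 => linePath
  | k + 1 => fun u v => if h : u ∈ K ∧ v ∈ K then (c u v h.1 h.2).path (approxPath c k)
      else linePath u v

namespace FS

lemma joined (h : FS n D K) (p q : ℝ × ℝ) (hp : p ∈ K) (hq : q ∈ K) : JoinedIn K p q := by
  have c : ∀ p q : ℝ × ℝ, p ∈ K → q ∈ K → PChain n D K p q := fun p q hp hq =>
    (h.exists_chain p q hp hq).some
  have n2 := h.n2
  have npos : (0:ℝ) < n := by linarith
  let r : ℝ := (n:ℝ)⁻¹
  have r0 : 0 < r := inv_pos.2 npos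
  have r1 : r < 1 := inv_lt_one_of_one_lt₀ (by linarith)
  have hsucc : ∀ k u v (hu : u ∈ K) (hv : v ∈ K),
      approxPath c (k+1) u v = (c u v hu hv).path (approxPath c k) := by
    intro k u v hu hv
    simp [approxPath, hu, hv]
  -- closeness to K
  have hnear : ∀ k, ∀ u ∈ K, ∀ v ∈ K, ∀ t, ∃ z ∈ K, dist (approxPath c k u v t) z ≤ r ^ k := by
    intro k
    induction k with
    | zero =>
      intro u hu v hv t
      refine ⟨u, hu, ?_⟩
      change dist (AffineMap.lineMap u v (t:ℝ)) u ≤ _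
      rw [dist_lineMap_left]
      have a1 := h.unit u hu
      have a2 := h.unit v hv
      have : dist u v ≤ 1 := by
        rw [Prod.dist_eq, max_le_iff, Real.dist_eq, Real.dist_eq, abs_le, abs_le]
        refine ⟨⟨?_, ?_⟩, ?_, ?_⟩ <;> linarith
      rw [Real.norm_eq_abs, abs_of_nonneg t.2.1, pow_zero]
      exact mul_le_one₀ t.2.2 dist_nonneg this
    | succ k ih =>
      intro u hu v hv t
      rw [hsucc k u v hu hv]
      refine PChain.path_rel (fun x _ => ∃ z ∈ K, dist x z ≤ r ^ (k+1)) _ (approxPath c k) ?_ _ t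
      intro d hd u hu v hv t
      obtain ⟨z, hz, hzd⟩ := ih u hu v hv t
      refine ⟨pieceMap n d z, (h.hmem _).2 ⟨d, hd, z, hz, rfl⟩, ?_⟩
      rw [pieceMap_dist, pow_succ']
      exact mul_le_mul_of_nonneg_left hzd r0.le
  have hstep : ∀ k, ∀ u ∈ K, ∀ v ∈ K, ∀ t,
      dist (approxPath c k u v t) (approxPath c (k+1) u v t) ≤ 3 * r ^ k := by
    intro k
    induction k with
    | zero =>
      intro u hu v hv t
      obtain ⟨z, hz, hzd⟩ := hnear 0 u hu v hv t
      obtain ⟨w, hw, hwd⟩ := hnear 1 u hu v hv t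
      have a1 := h.unit z hz
      have a2 := h.unit w hw
      have : dist z w ≤ 1 := by
        rw [Prod.dist_eq, max_le_iff, Real.dist_eq, Real.dist_eq, abs_le, abs_le]
        refine ⟨⟨?_, ?_⟩, ?_, ?_⟩ <;> linarith
      have t1 := dist_triangle4 (approxPath c 0 u v t) z w (approxPath c (0+1) u v t)
      rw [dist_comm w] at t1
      rw [pow_zero] at *
      rw [pow_one] at hwd
      simp only [zero_add] at *
      linarith
    | succ k ih =>
      intro u hu v hv t
      rw [hsucc k u v hu hv, hsucc (k+1) u v hu hv]
      refine PChain.path_rel (fun x y => dist x y ≤ 3 * r ^ (k+1)) (approxPath c k)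
        (approxPath c (k+1)) ?_ _ t
      intro d hd u hu v hv t
      rw [pieceMap_dist, pow_succ']
      have := mul_le_mul_of_nonneg_left (ih u hu v hv t) r0.le
      change r * _ ≤ _
      linarith
  let γ : ℕ → C(unitInterval, ℝ × ℝ) := fun k => (approxPath c k p q).toContinuousMap
  have hcau : CauchySeq γ := cauchySeq_of_le_geometric r 3 r1 fun k => by
    rw [ContinuousMap.dist_le (by positivity)]
    exact fun t => hstep k p hp q hq t
  obtain ⟨G, hG⟩ := cauchySeq_tendsto_of_complete hcau
  have hev : ∀ t, Filter.Tendsto (fun k => approxPath c k p q t) Filter.atTop (nhds (G t)) :=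
    fun t => ((continuous_eval_const (F := C(unitInterval, ℝ × ℝ)) t).tendsto G).comp hG
  refine ⟨⟨G, ?_, ?_⟩, ?_⟩
  · have := hev 0
    simp only [Path.source] at this
    exact tendsto_nhds_unique this tendsto_const_nhds
  · have := hev 1
    simp only [Path.target] at this
    exact tendsto_nhds_unique this tendsto_const_nhds
  · intro t
    choose z hz hzd using fun k => hnear k p hp q hq t
    have hz0 : Filter.Tendsto (fun k => dist (approxPath c k p q t) (z k)) Filter.atTop (nhds 0) :=
      squeeze_zero (fun _ => dist_nonneg) hzd (tendsto_pow_atTop_nhds_zero_of_lt_one r0.le r1)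
    have := (tendsto_iff_of_dist hz0).1 (hev t)
    exact h.hcomp.isClosed.mem_of_tendsto this (Filter.Eventually.of_forall hz)

end FS

end

section
variable {n : ℕ} {D : Set (ℤ × ℤ)} {K : Set (ℝ × ℝ)}

namespace FS

lemma dpow_bound (h : FS n D K) (k : ℕ) : ∀ d ∈ Dpow n D k,
    (0 ≤ d.1 ∧ d.1 ≤ (n:ℤ)^k - 1) ∧ (0 ≤ d.2 ∧ d.2 ≤ (n:ℤ)^k - 1) := by
  have hn : (2:ℤ) ≤ n := by exact_mod_cast h.hn
  induction k with
  | zero => intro d hd; simp only [Dpow, mem_singleton_iff] at hd; subst hd; simp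
  | succ k ih =>
    rintro _ ⟨a, ha, b, hb, rfl⟩
    have h1 := ih a ha
    have h2 := h.hD b hb
    simp only [Prod.fst_add, Prod.snd_add, Prod.smul_fst, Prod.smul_snd, smul_eq_mul, pow_succ]
    refine ⟨⟨?_, ?_⟩, ?_, ?_⟩ <;> nlinarith

lemma dpow_lead (k : ℕ) : ∀ d, d ∈ Dpow n D (k+1) ↔ ∃ a ∈ D, ∃ r ∈ Dpow n D k,
    d = (((n:ℤ)^k * a.1 + r.1, (n:ℤ)^k * a.2 + r.2) : ℤ × ℤ) := by
  induction k with
  | zero =>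
    intro d
    constructor
    · rintro ⟨a, ha, b, hb, rfl⟩
      simp only [Dpow, mem_singleton_iff] at ha
      subst ha
      exact ⟨b, hb, (0,0), rfl, by ext <;> simp⟩
    · rintro ⟨a, ha, r, hr, rfl⟩
      simp only [Dpow, mem_singleton_iff] at hr
      subst hr
      exact ⟨(0,0), rfl, a, ha, by ext <;> simp⟩
  | succ k ih =>
    intro d
    constructor
    · rintro ⟨a, ha, b, hb, rfl⟩
      obtain ⟨a', ha', r, hr, rfl⟩ := (ih a).1 ha
      exact ⟨a', ha', (n:ℤ) • r + b, ⟨r, hr, b, hb, rfl⟩, by ext <;> simp <;> ring⟩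
    · rintro ⟨a, ha, _, ⟨r, hr, b, hb, rfl⟩, rfl⟩
      exact ⟨((n:ℤ)^k * a.1 + r.1, (n:ℤ)^k * a.2 + r.2), (ih _).2 ⟨a, ha, r, hr, rfl⟩, b, hb, by
        ext <;> simp <;> ring⟩

lemma kpow (h : FS n D K) (k : ℕ) : ∀ x, x ∈ K ↔ ∃ d ∈ Dpow n D k, ∃ y ∈ K,
    (n:ℝ)^k * x.1 = y.1 + d.1 ∧ (n:ℝ)^k * x.2 = y.2 + d.2 := by
  have n2 := h.n2
  have npos : (0:ℝ) < n := by linarith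
  induction k with
  | zero =>
    intro x
    simp only [Dpow, mem_singleton_iff, exists_eq_left]
    constructor
    · intro hx; exact ⟨x, hx, by simp, by simp⟩
    · rintro ⟨y, hy, h1, h2⟩
      have : x = y := by
        ext
        · simpa using h1
        · simpa using h2
      rwa [this]
  | succ k ih =>
    intro x
    rw [ih]
    constructor
    · rintro ⟨d, hd, y, hy, h1, h2⟩
      obtain ⟨b, hb, z, hz, rfl⟩ := (h.hmem y).1 hy
      refine ⟨_, ⟨d, hd, b, hb, rfl⟩, z, hz, ?_, ?_⟩
      · simp [pieceMap, coeZ2] at h1 ⊢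
        rw [pow_succ', mul_assoc, h1]; field_simp; ring
      · simp [pieceMap, coeZ2] at h2 ⊢
        rw [pow_succ', mul_assoc, h2]; field_simp; ring
    · rintro ⟨_, ⟨a, ha, b, hb, rfl⟩, z, hz, h1, h2⟩
      refine ⟨a, ha, pieceMap n b z, (h.hmem _).2 ⟨b, hb, z, hz, rfl⟩, ?_, ?_⟩
      · simp [pieceMap, coeZ2] at h1 ⊢
        apply mul_left_cancel₀ npos.ne'
        rw [← mul_assoc, ← pow_succ', h1]; field_simp; ring
      · simp [pieceMap, coeZ2] at h2 ⊢
        apply mul_left_cancel₀ npos.ne'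
        rw [← mul_assoc, ← pow_succ', h2]; field_simp; ring

end FS

/-- Relative positions of distinct pieces of the same order. -/
def Reach (n : ℕ) (D : Set (ℤ × ℤ)) (e : ℤ × ℤ) : Prop :=
  e ≠ 0 ∧ ∃ k, ∃ d ∈ Dpow n D k, ∃ d' ∈ Dpow n D k, d' - d = e

namespace FS

lemma reach_symm {e : ℤ × ℤ} (h : Reach n D e) : Reach n D (-e) := by
  obtain ⟨h0, k, d, hd, d', hd', e1⟩ := h
  exact ⟨neg_ne_zero.2 h0, k, d', hd', d, hd, by rw [← e1]; abel⟩

lemma mem_critical (x : ℝ × ℝ) : x ∈ criticalSet n D K ↔ ∃ d ∈ D, ∃ d' ∈ D, d ≠ d' ∧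
    ∃ u ∈ K, ∃ v ∈ K, pieceMap n d u = x ∧ pieceMap n d' v = x := by
  simp only [criticalSet, mem_iUnion, mem_inter_iff, mem_image, exists_prop]
  constructor
  · rintro ⟨d, hd, d', hd', hne, ⟨u, hu, e1⟩, v, hv, e2⟩
    exact ⟨d, hd, d', hd', hne, u, hu, v, hv, e1, e2⟩
  · rintro ⟨d, hd, d', hd', hne, u, hu, v, hv, e1, e2⟩
    exact ⟨d, hd, d', hd', hne, ⟨u, hu, e1⟩, v, hv, e2⟩

lemma pieceMap_eq (h : FS n D K) (d : ℤ × ℤ) (u x : ℝ × ℝ) :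
    pieceMap n d u = x ↔ n * x.1 = u.1 + d.1 ∧ n * x.2 = u.2 + d.2 := by
  have n2 := h.n2
  have npos : (0:ℝ) < n := by linarith
  constructor
  · rintro rfl
    simp [pieceMap, coeZ2]
    constructor <;> field_simp
  · rintro ⟨h1, h2⟩
    ext
    · simp [pieceMap, coeZ2]; field_simp; linarith
    · simp [pieceMap, coeZ2]; field_simp; linarith

lemma boundary_of (h : FS n D K) (k : ℕ) : ∀ d ∈ Dpow n D k, ∀ d' ∈ Dpow n D k, d ≠ d' →
    ∀ x ∈ K, ∀ y ∈ K, x.1 + d.1 = y.1 + d'.1 → x.2 + d.2 = y.2 + d'.2 → x ∈ ssBoundary n D K := by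
  have n2 := h.n2
  have npos : (0:ℝ) < n := by linarith
  induction k with
  | zero =>
    intro d hd d' hd' hne
    simp only [Dpow, mem_singleton_iff] at hd hd'
    exact absurd (hd.trans hd'.symm) hne
  | succ k ih =>
    intro d hd d' hd' hne x hx y hy e1 e2
    obtain ⟨a, ha, r, hr, hdr⟩ := (dpow_lead k d).1 hd
    obtain ⟨a', ha', r', hr', hdr'⟩ := (dpow_lead k d').1 hd'
    have c1 : (d.1:ℝ) = n^k * a.1 + r.1 := by rw [hdr]; push_cast; ring
    have c2 : (d.2:ℝ) = n^k * a.2 + r.2 := by rw [hdr]; push_cast; ring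
    have c1' : (d'.1:ℝ) = n^k * a'.1 + r'.1 := by rw [hdr']; push_cast; ring
    have c2' : (d'.2:ℝ) = n^k * a'.2 + r'.2 := by rw [hdr']; push_cast; ring
    by_cases haa : a = a'
    · subst haa
      refine ih r hr r' hr' (fun e => hne ?_) x hx y hy (by linarith) (by linarith)
      rw [hdr, hdr', e]
    · refine ⟨hx, k+1, by omega, d, hd, ?_⟩
      rw [mem_critical]
      refine ⟨a, ha, a', ha', haa, ((n:ℝ)^k)⁻¹ • (x + coeZ2 r), ?_, ((n:ℝ)^k)⁻¹ • (y + coeZ2 r'), ?_, ?_, ?_⟩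
      · refine (h.kpow k _).2 ⟨r, hr, x, hx, ?_, ?_⟩ <;> simp [coeZ2] <;> field_simp
      · refine (h.kpow k _).2 ⟨r', hr', y, hy, ?_, ?_⟩ <;> simp [coeZ2] <;> field_simp
      · rw [h.pieceMap_eq]
        constructor
        · simp [coeZ2]; rw [pow_succ, c1]; field_simp; ring
        · simp [coeZ2]; rw [pow_succ, c2]; field_simp; ring
      · rw [h.pieceMap_eq]
        constructor
        · simp [coeZ2]; rw [pow_succ]; field_simp; linarith
        · simp [coeZ2]; rw [pow_succ]; field_simp; linarith

lemma mem_boundary (h : FS n D K) (x : ℝ × ℝ) : x ∈ ssBoundary n D K ↔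
    ∃ e : ℤ × ℤ, Reach n D e ∧ x ∈ K ∧ (x.1 - e.1, x.2 - e.2) ∈ K := by
  have n2 := h.n2
  have npos : (0:ℝ) < n := by linarith
  constructor
  · rintro ⟨hx, k, hk, d, hd, hcr⟩
    obtain ⟨k, rfl⟩ : ∃ j, k = j + 1 := ⟨k - 1, by omega⟩
    rw [mem_critical] at hcr
    obtain ⟨a, ha, b, hb, hab, u, hu, v, hv, e1, e2⟩ := hcr
    rw [h.pieceMap_eq] at e1 e2
    have main : ∀ a ∈ D, ∀ u ∈ K, n * (((n:ℝ)^(k+1))⁻¹ • (x + coeZ2 d)).1 = u.1 + a.1 →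
      n * (((n:ℝ)^(k+1))⁻¹ • (x + coeZ2 d)).2 = u.2 + a.2 → ∃ r ∈ Dpow n D k, ∃ w ∈ K, 
        x.1 + d.1 = w.1 + (n^k * a.1 + r.1) ∧ x.2 + d.2 = w.2 + (n^k * a.2 + r.2) := by
      intro a ha u hu h1 h2
      obtain ⟨r, hr, w, hw, w1, w2⟩ := (h.kpow k u).1 hu
      refine ⟨r, hr, w, hw, ?_, ?_⟩
      · simp [coeZ2, pow_succ] at h1
        field_simp at h1
        linarith
      · simp [coeZ2, pow_succ] at h2
        field_simp at h2
        linarith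
    obtain ⟨r, hr, w, hw, w1, w2⟩ := main a ha u hu e1.1 e1.2
    obtain ⟨r', hr', w', hw', w1', w2'⟩ := main b hb v hv e2.1 e2.2
    set A : ℤ × ℤ := ((n:ℤ)^k * a.1 + r.1, (n:ℤ)^k * a.2 + r.2) with hA
    set B : ℤ × ℤ := ((n:ℤ)^k * b.1 + r'.1, (n:ℤ)^k * b.2 + r'.2) with hB
    have hAm : A ∈ Dpow n D (k+1) := (dpow_lead k _).2 ⟨a, ha, r, hr, rfl⟩
    have hBm : B ∈ Dpow n D (k+1) := (dpow_lead k _).2 ⟨b, hb, r', hr', rfl⟩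
    have hABne : A ≠ B := by
      intro e
      apply hab
      have b1 := h.dpow_bound k r hr
      have b2 := h.dpow_bound k r' hr'
      have hp : (0:ℤ) < (n:ℤ)^k := by
        have : (0:ℤ) < n := by exact_mod_cast npos
        positivity
      rw [hA, hB, Prod.mk.injEq] at e
      have lem : ∀ N x y s t : ℤ, 0 < N → 0 ≤ s → s ≤ N - 1 → 0 ≤ t → t ≤ N - 1 →
          N * x + s = N * y + t → x = y := by
        intro N x y s t hN s0 s1 t0 t1 e
        rcases lt_trichotomy x y with hl | hl | hl
        · nlinarith
        · exact hl
        · nlinarith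
      ext
      · exact lem _ _ _ _ _ hp b1.1.1 b1.1.2 b2.1.1 b2.1.2 e.1
      · exact lem _ _ _ _ _ hp b1.2.1 b1.2.2 b2.2.1 b2.2.2 e.2
    by_cases hdA : A = d
    · have hdB : B ≠ d := fun e => hABne (hdA.trans e.symm)
      refine ⟨B - d, ⟨sub_ne_zero.2 hdB, k+1, d, hd, B, hBm, rfl⟩, hx, ?_⟩
      convert hw' using 1
      ext
      · simp [hB]; linarith
      · simp [hB]; linarith
    · refine ⟨A - d, ⟨sub_ne_zero.2 hdA, k+1, d, hd, A, hAm, rfl⟩, hx, ?_⟩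
      convert hw using 1
      ext
      · simp [hA]; linarith
      · simp [hA]; linarith
  · rintro ⟨e, ⟨e0, k, d, hd, d', hd', rfl⟩, hx, hy⟩
    refine h.boundary_of k d hd d' hd' (fun e => e0 (by rw [e, sub_self])) x hx _ hy ?_ ?_
    · simp; ring
    · simp; ring

/-- Two translates in adjacent position contain no circle. -/
lemma noCirc_union (h : FS n D K) (e : ℤ × ℤ) (he : Reach n D e) :
    NoCirc (K ∪ {x | (x.1 - e.1, x.2 - e.2) ∈ K}) := by
  have n2 := h.n2
  have npos : (0:ℝ) < n := by linarith
  obtain ⟨-, k, d, hd, d', hd', rfl⟩ := he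
  refine h.hnoc.of_image (fun x => ((n:ℝ)^k)⁻¹ • (x + coeZ2 d)) (by fun_prop) ?_ ?_
  · intro x y hxy
    have : ((n:ℝ)^k)⁻¹ ≠ 0 := by positivity
    exact add_right_cancel (smul_right_injective _ this hxy)
  · rintro x (hx | hx)
    · refine (h.kpow k _).2 ⟨d, hd, x, hx, ?_, ?_⟩ <;> simp [coeZ2] <;> field_simp
    · refine (h.kpow k _).2 ⟨d', hd', _, hx, ?_, ?_⟩ <;> simp [coeZ2] <;> field_simp <;> ring

/-- If a vertical side of the unit square meets `K` in a nondegenerate segment,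
it is contained in `K`. -/
lemma blow (h : FS n D K) (ε : ℤ) (hε : ε = 0 ∨ ε = 1) (s t : ℝ) (hs : 0 ≤ s) (hst : s < t)
    (hseg : ∀ y, s ≤ y → y ≤ t → ((ε:ℝ), y) ∈ K) : ∀ y, 0 ≤ y → y ≤ 1 → ((ε:ℝ), y) ∈ K := by
  have n2 := h.n2
  have npos : (0:ℝ) < n := by linarith
  obtain ⟨k, hk⟩ : ∃ k : ℕ, 2 / (t - s) < (n:ℝ)^k := pow_unbounded_of_one_lt _ (by linarith)
  have hkp : (0:ℝ) < (n:ℝ)^k := by positivity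
  rw [div_lt_iff₀ (by linarith)] at hk
  set j : ℤ := ⌈(n:ℝ)^k * s⌉ with hj
  have j1 : (n:ℝ)^k * s ≤ j := Int.le_ceil _
  have j2 : (j:ℝ) < (n:ℝ)^k * s + 1 := Int.ceil_lt_add_one _
  have hIoo : ∀ y, 0 < y → y < 1 → ((ε:ℝ), y) ∈ K := by
    intro y y0 y1
    have hm := hseg ((y + j) / (n:ℝ)^k) (by rw [le_div_iff₀ hkp]; linarith)
      (by rw [div_le_iff₀ hkp]; linarith)
    obtain ⟨d, hd, z, hz, e1, e2⟩ := (h.kpow k _).1 hm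
    have hb := h.dpow_bound k d hd
    have hu := h.unit z hz
    have b1 : (0:ℝ) ≤ d.1 := by exact_mod_cast hb.1.1
    have b2 : (d.1:ℝ) ≤ (n:ℝ)^k - 1 := by exact_mod_cast hb.1.2
    simp only at e1 e2
    have hz1 : z.1 = ε := by
      rcases hε with rfl | rfl
      · simp at e1 ⊢; linarith
      · simp at e1 ⊢; linarith
    have e2' : y + j = z.2 + d.2 := by
      rw [← e2]; field_simp
    have l1 : (d.2:ℝ) < j + 1 := by linarith
    have l2 : (j:ℝ) < d.2 + 1 := by linarith
    have : d.2 = j := by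
      have l1' : d.2 < j + 1 := by exact_mod_cast l1
      have l2' : j < d.2 + 1 := by exact_mod_cast l2
      omega
    rw [this] at e2'
    have hz2 : z.2 = y := by linarith
    have : z = ((ε:ℝ), y) := by ext <;> assumption
    rwa [← this]
  have hcl : IsClosed ((fun y : ℝ => ((ε:ℝ), y)) ⁻¹' K) :=
    h.hcomp.isClosed.preimage (by fun_prop)
  have : closure (Ioo (0:ℝ) 1) ⊆ (fun y : ℝ => ((ε:ℝ), y)) ⁻¹' K :=
    closure_minimal (fun y hy => hIoo y hy.1 hy.2) hcl
  rw [closure_Ioo (by norm_num)] at this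
  exact fun y h0 h1 => this ⟨h0, h1⟩

/-- `K` cannot contain both vertical sides of the unit square. -/
lemma not_both (h : FS n D K) (hL : ∀ y, 0 ≤ y → y ≤ 1 → ((0:ℝ), y) ∈ K)
    (hR : ∀ y, 0 ≤ y → y ≤ 1 → ((1:ℝ), y) ∈ K) : False := by
  have n2 := h.n2
  have npos : (0:ℝ) < n := by linarith
  have nz : (n:ℝ) ≠ 0 := npos.ne'
  have digit : ∀ j : ℤ, 0 ≤ j → j ≤ n - 1 → ((0:ℤ), j) ∈ D ∧ ((n:ℤ) - 1, j) ∈ D := by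
    intro j j0 j1
    have j0' : (0:ℝ) ≤ j := by exact_mod_cast j0
    have j1' : (j:ℝ) ≤ n - 1 := by exact_mod_cast j1
    have y0 : 0 ≤ ((j:ℝ) + 1/2) / n := by positivity
    have y1 : ((j:ℝ) + 1/2) / n ≤ 1 := by rw [div_le_one npos]; linarith
    have sec : ∀ d : ℤ × ℤ, ∀ z ∈ K, n * (((j:ℝ) + 1/2) / n) = z.2 + d.2 → d.2 = j := by
      intro d z hz e
      have hu := h.unit z hz
      rw [mul_div_cancel₀ _ nz] at e
      have l1 : (d.2:ℝ) < j + 1 := by linarith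
      have l2 : (j:ℝ) < d.2 + 1 := by linarith
      have l1' : d.2 < j + 1 := by exact_mod_cast l1
      have l2' : j < d.2 + 1 := by exact_mod_cast l2
      omega
    constructor
    · obtain ⟨d, hd, z, hz, e⟩ := (h.hmem _).1 (hL _ y0 y1)
      rw [h.pieceMap_eq] at e
      have hb := (h.hD d hd).1.1
      have hb' : (0:ℝ) ≤ d.1 := by exact_mod_cast hb
      have hu := h.unit z hz
      have e1 := e.1
      simp only [mul_zero] at e1
      have : (d.1:ℝ) = 0 := by linarith
      have hd1 : d.1 = 0 := by exact_mod_cast this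
      have : d = (0, j) := by ext; exacts [hd1, sec d z hz e.2]
      rwa [← this]
    · obtain ⟨d, hd, z, hz, e⟩ := (h.hmem _).1 (hR _ y0 y1)
      rw [h.pieceMap_eq] at e
      have hb := (h.hD d hd).1.2
      have hb' : (d.1:ℝ) ≤ n - 1 := by exact_mod_cast hb
      have hu := h.unit z hz
      have e1 := e.1
      simp only [mul_one] at e1
      have : (d.1:ℝ) = n - 1 := by linarith
      have hd1 : d.1 = (n:ℤ) - 1 := by exact_mod_cast this
      have : d = ((n:ℤ) - 1, j) := by ext; exacts [hd1, sec d z hz e.2]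
      rwa [← this]
  rcases eq_or_lt_of_le h.hn with hn | hn
  · -- n = 2
    obtain ⟨d, ⟨a1, a2⟩, ⟨a3, a4⟩, hd⟩ := h.hfull
    have := digit d.2 a3 a4
    have hc : d.1 = 0 ∨ d.1 = (n:ℤ) - 1 := by omega
    rcases hc with hc | hc
    · exact hd (by rw [show d = (0, d.2) from Prod.ext hc rfl]; exact this.1)
    · exact hd (by rw [show d = ((n:ℤ) - 1, d.2) from Prod.ext hc rfl]; exact this.2)
  have n3 : (3:ℝ) ≤ n := by exact_mod_cast hn
  have hnz : (3:ℤ) ≤ n := by exact_mod_cast hn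
  set r : ℝ := 1 / n with hr
  have r0 : 0 < r := by positivity
  have nr : n * r = 1 := by rw [hr]; field_simp
  set d0 : ℤ × ℤ := (0, 0) with hd0
  set d1 : ℤ × ℤ := (0, (n:ℤ) - 1) with hd1
  have d0m : d0 ∈ D := (digit 0 le_rfl (by omega)).1
  have d1m : d1 ∈ D := (digit ((n:ℤ) - 1) (by omega) le_rfl).1
  let V : Set (ℝ × ℝ) := (fun y : ℝ => (r, y)) '' Icc 0 1
  have hV : V ⊆ K := by
    rintro _ ⟨y, ⟨y0, y1⟩, rfl⟩
    -- digit of y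
    obtain ⟨j, j0, j1, f0, f1⟩ : ∃ j : ℤ, 0 ≤ j ∧ j ≤ n - 1 ∧ 0 ≤ n * y - j ∧ n * y - j ≤ 1 := by
      rcases eq_or_lt_of_le y1 with rfl | y1
      · exact ⟨(n:ℤ) - 1, by omega, le_rfl, by push_cast; linarith, by push_cast; linarith⟩
      · refine ⟨⌊n * y⌋, Int.floor_nonneg.2 (by positivity), ?_, ?_, ?_⟩
        · have : ⌊n * y⌋ < (n:ℤ) := by
            rw [Int.floor_lt]; push_cast; nlinarith
          omega
        · linarith [Int.floor_le (n * y)]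
        · linarith [Int.lt_floor_add_one (n * y)]
    refine (h.hmem _).2 ⟨(0, j), (digit j j0 j1).1, (1, n * y - j), hR _ f0 f1, ?_⟩
    rw [h.pieceMap_eq]
    constructor
    · simp [nr]
    · simp
  let W : Set (ℝ × ℝ) := pieceMap n d0 '' K ∪ V ∪ pieceMap n d1 '' K
  have hWK : W ⊆ K := by
    rintro x ((⟨y, hy, rfl⟩ | hx) | ⟨y, hy, rfl⟩)
    · exact (h.hmem _).2 ⟨d0, d0m, y, hy, rfl⟩
    · exact hV hx
    · exact (h.hmem _).2 ⟨d1, d1m, y, hy, rfl⟩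
  have jm : ∀ (d : ℤ × ℤ) (x y p q : ℝ × ℝ), x ∈ K → y ∈ K → pieceMap n d x = p →
      pieceMap n d y = q → JoinedIn (pieceMap n d '' K) p q := by
    rintro d x y p q hx hy rfl rfl
    have hpc : IsPathConnected (pieceMap n d '' K) := by
      have : IsPathConnected K := ⟨x, hx, fun {y} hy => h.joined x y hx hy⟩
      exact this.image (pieceMap_cont n d)
    exact hpc.joinedIn _ ⟨x, hx, rfl⟩ _ ⟨y, hy, rfl⟩
  have j1 : JoinedIn W (0, 0) (r, 0) := by
    refine (jm d0 (0,0) (1,0) _ _ (hL 0 le_rfl zero_le_one) (hR 0 le_rfl zero_le_one) ?_ ?_).mono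
      (fun x hx => Or.inl (Or.inl hx))
    · rw [h.pieceMap_eq]; simp [d0]
    · rw [h.pieceMap_eq]; simp [d0, nr]
  have j2 : JoinedIn W (r, 0) (r, 1) := by
    have : IsPathConnected V := ((convex_Icc (0:ℝ) 1).isPathConnected ⟨0, by simp⟩).image
      (by fun_prop)
    exact (this.joinedIn _ ⟨0, by simp, rfl⟩ _ ⟨1, by simp, rfl⟩).mono (fun x hx => Or.inl (Or.inr hx))
  have j3 : JoinedIn W (r, 1) (0, 1) := by
    refine (jm d1 (1,1) (0,1) _ _ (hR 1 zero_le_one le_rfl) (hL 1 zero_le_one le_rfl) ?_ ?_).mono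
      (fun x hx => Or.inr hx)
    · rw [h.pieceMap_eq]; simp [d1, nr]
    · rw [h.pieceMap_eq]; simp [d1]
  have hhalf := arc_sub K h.hnoc W hWK (fun t => ((0:ℝ), t)) (by fun_prop)
    (fun s _ t _ e => by simpa using e) (fun t ht => hL t ht.1 ht.2) ((j1.trans j2).trans j3)
    (1/2) (by constructor <;> norm_num)
  rcases hhalf with (⟨y, hy, e⟩ | ⟨y, hy, e⟩) | ⟨y, hy, e⟩
  · rw [h.pieceMap_eq] at e
    have := h.unit y hy
    have e2 := e.2
    simp [d0] at e2
    linarith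
  · simp at e
    linarith [e.1]
  · rw [h.pieceMap_eq] at e
    have := h.unit y hy
    have e2 := e.2
    simp [d1] at e2
    linarith

/-- Horizontally adjacent pieces meet in at most one point. -/
lemma uniq_h (h : FS n D K) (he : Reach n D (1, 0)) (s t : ℝ) (hst : s < t)
    (s1 : ((1:ℝ), s) ∈ K) (s0 : ((0:ℝ), s) ∈ K) (t1 : ((1:ℝ), t) ∈ K) (t0 : ((0:ℝ), t) ∈ K) :
    False := by
  have hnc := h.noCirc_union _ he
  set B : Set (ℝ × ℝ) := {x | (x.1 - ((1:ℤ):ℝ), x.2 - ((0:ℤ):ℝ)) ∈ K} with hB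
  obtain ⟨γ, hγ⟩ := h.joined _ _ s1 t1
  obtain ⟨g, gc, gi, g0, g1, gr⟩ := exists_arc γ.extend γ.continuous_extend (by
    simp; exact hst.ne)
  rw [Path.extend_zero] at g0
  rw [Path.extend_one] at g1
  have gK : ∀ u ∈ Icc (0:ℝ) 1, g u ∈ K := by
    intro u hu
    obtain ⟨v, hv, e⟩ := gr u hu
    rw [← e, Path.extend_apply _ hv]
    exact hγ _
  have hBj : JoinedIn B (g 0) (g 1) := by
    rw [g0, g1]
    have hpc : IsPathConnected ((fun x : ℝ × ℝ => (x.1 + 1, x.2)) '' K) := by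
      have : IsPathConnected K := ⟨_, s0, fun {y} hy => h.joined _ y s0 hy⟩
      exact this.image (by fun_prop)
    refine (hpc.joinedIn _ ⟨_, s0, by simp⟩ _ ⟨_, t0, by simp⟩).mono ?_
    rintro _ ⟨x, hx, rfl⟩
    simpa [hB] using hx
  have gB := arc_sub _ hnc B subset_union_right g gc gi (fun u hu => Or.inl (gK u hu)) hBj
  have line : ∀ u ∈ Icc (0:ℝ) 1, (g u).1 = 1 := by
    intro u hu
    have a1 := h.unit _ (gK u hu)
    have a2 := h.unit _ (gB u hu)
    simp at a2
    linarith
  have cover : ∀ y, s ≤ y → y ≤ t → ∃ u ∈ Icc (0:ℝ) 1, g u = (1, y) := by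
    intro y h1 h2
    have hivt := intermediate_value_Icc (zero_le_one (α := ℝ)) (continuous_snd.comp_continuousOn gc)
    simp only [Function.comp, g0, g1] at hivt
    obtain ⟨u, hu, e⟩ := hivt ⟨h1, h2⟩
    exact ⟨u, hu, Prod.ext (line u hu) e⟩
  have hs0 := (h.unit _ s1).2.1
  have R := h.blow 1 (Or.inr rfl) s t hs0 hst (fun y h1 h2 => by
    obtain ⟨u, hu, e⟩ := cover y h1 h2
    have := gK u hu
    rw [e] at this
    simpa using this)
  have L := h.blow 0 (Or.inl rfl) s t hs0 hst (fun y h1 h2 => by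
    obtain ⟨u, hu, e⟩ := cover y h1 h2
    have := gB u hu
    rw [e] at this
    simpa [hB] using this)
  exact h.not_both (fun y h1 h2 => by simpa using L y h1 h2) (fun y h1 h2 => by simpa using R y h1 h2)

end FS

end

section
variable {n : ℕ} {D : Set (ℤ × ℤ)} {K : Set (ℝ × ℝ)}

namespace FS

lemma swap (h : FS n D K) : FS n (Prod.swap ⁻¹' D) (Prod.swap ⁻¹' K) where
  hn := h.hn
  hD d hd := ⟨(h.hD _ hd).2, (h.hD _ hd).1⟩
  hne := by obtain ⟨x, hx⟩ := h.hne; exact ⟨x.swap, by simpa using hx⟩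
  hcomp := by
    rw [← image_swap_eq_preimage_swap]
    exact h.hcomp.image continuous_swap
  hconn := by
    rw [← image_swap_eq_preimage_swap]
    exact h.hconn.image _ continuous_swap.continuousOn
  hmem x := by
    simp only [mem_preimage]
    rw [h.hmem]
    constructor
    · rintro ⟨d, hd, y, hy, e⟩
      refine ⟨d.swap, by simpa using hd, y.swap, by simpa using hy, ?_⟩
      rw [← Prod.swap_swap x, ← e]; rfl
    · rintro ⟨d, hd, y, hy, e⟩
      refine ⟨d.swap, by simpa using hd, y.swap, by simpa using hy, ?_⟩
      rw [← e]; rfl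
  hnoc := h.hnoc.of_image Prod.swap continuous_swap Prod.swap_injective (fun x hx => hx)
  hfull := by
    obtain ⟨d, h1, h2, h3⟩ := h.hfull
    exact ⟨d.swap, h2, h1, by simpa using h3⟩

lemma dpow_swap (k : ℕ) : ∀ d ∈ Dpow n D k, d.swap ∈ Dpow n (Prod.swap ⁻¹' D) k := by
  induction k with
  | zero =>
    intro d hd
    simp only [Dpow, mem_singleton_iff] at *
    subst hd; rfl
  | succ k ih =>
    rintro _ ⟨a, ha, b, hb, rfl⟩
    exact ⟨a.swap, ih a ha, b.swap, by simpa using hb, rfl⟩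

lemma reach_swap {e : ℤ × ℤ} (he : Reach n D e) : Reach n (Prod.swap ⁻¹' D) e.swap := by
  obtain ⟨h0, k, d, hd, d', hd', rfl⟩ := he
  refine ⟨fun e => h0 ?_, k, _, dpow_swap k d hd, _, dpow_swap k d' hd', rfl⟩
  have := congrArg Prod.swap e
  simpa using this

lemma uniq_h' (h : FS n D K) (he : Reach n D (1, 0)) (s t : ℝ)
    (s1 : ((1:ℝ), s) ∈ K) (s0 : ((0:ℝ), s) ∈ K) (t1 : ((1:ℝ), t) ∈ K) (t0 : ((0:ℝ), t) ∈ K) :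
    s = t := by
  rcases lt_trichotomy s t with hl | hl | hl
  · exact (h.uniq_h he s t hl s1 s0 t1 t0).elim
  · exact hl
  · exact (h.uniq_h he t s hl t1 t0 s1 s0).elim

lemma uniq_v' (h : FS n D K) (he : Reach n D (0, 1)) (s t : ℝ)
    (s1 : (s, (1:ℝ)) ∈ K) (s0 : (s, (0:ℝ)) ∈ K) (t1 : (t, (1:ℝ)) ∈ K) (t0 : (t, (0:ℝ)) ∈ K) :
    s = t :=
  h.swap.uniq_h' (reach_swap he) s t s1 s0 t1 t0

/-- If all contacts between pieces happen in one direction, then `K` is a segment. -/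
lemma seg_of_dir (h : FS n D K) (α β : ℤ) (hαβ : ¬ (α = 0 ∧ β = 0))
    (hE : ∀ e : ℤ × ℤ, Reach n D e → (∃ x ∈ K, (x.1 - e.1, x.2 - e.2) ∈ K) →
      α * e.1 + β * e.2 = 0) : ∃ a b : ℝ × ℝ, K = segment ℝ a b := by
  have n2 := h.n2
  have npos : (0:ℝ) < n := by linarith
  obtain ⟨p0, hp0⟩ := h.hne
  obtain ⟨d0, hd0, -⟩ := (h.hmem p0).1 hp0
  set c : ℤ := α * d0.1 + β * d0.2 with hc
  have hall : ∀ d ∈ D, α * d.1 + β * d.2 = c := by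
    by_contra hcon
    push Not at hcon
    obtain ⟨d, hd, hd1, d', hd', hd1', u, hu, v, hv, e⟩ := h.conn {d | α * d.1 + β * d.2 = c}
      ⟨d0, hd0, rfl⟩ hcon
    have e1 := (h.pieceMap_eq d u _).1 e
    have e2 := (h.pieceMap_eq d' v _).1 rfl
    have m1 : ∀ d ∈ D, d ∈ Dpow n D 1 := fun d hd => ⟨(0,0), rfl, d, hd, by ext <;> simp⟩
    have hne : d' - d ≠ 0 := by
      intro e
      rw [sub_eq_zero] at e
      rw [e] at hd1'
      exact hd1' hd1
    have := hE (d' - d) ⟨hne, 1, d, m1 d hd, d', m1 d' hd', rfl⟩ ⟨u, hu, by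
      convert hv using 1
      ext
      · simp; linarith
      · simp; linarith⟩
    simp only [mem_setOf_eq] at hd1 hd1'
    apply hd1'
    simp at this
    linarith
  -- the linear functional is constant on K
  let l : ℝ × ℝ → ℝ := fun x => α * x.1 + β * x.2
  have hl : ∀ x ∈ K, (n - 1) * l x = c := by
    obtain ⟨M, hM, hMm⟩ := h.hcomp.exists_isMaxOn ⟨p0, hp0⟩ (f := l) (by fun_prop)
    obtain ⟨m, hm, hmm⟩ := h.hcomp.exists_isMinOn ⟨p0, hp0⟩ (f := l) (by fun_prop)
    rw [isMaxOn_iff] at hMm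
    rw [isMinOn_iff] at hmm
    have st : ∀ x ∈ K, ∃ y ∈ K, n * l x = l y + c := by
      intro x hx
      obtain ⟨d, hd, y, hy, e⟩ := (h.hmem x).1 hx
      rw [h.pieceMap_eq] at e
      have e0 : (α:ℝ) * d.1 + β * d.2 = c := by exact_mod_cast hall d hd
      refine ⟨y, hy, ?_⟩
      simp only [l]
      linear_combination (α:ℝ) * e.1 + β * e.2 + e0
    intro x hx
    obtain ⟨y, hy, e⟩ := st M hM
    obtain ⟨y', hy', e'⟩ := st m hm
    have a1 := hMm y hy
    have a2 := hmm y' hy'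
    have a3 := hMm x hx
    have a4 := hmm x hx
    apply le_antisymm <;> nlinarith
  have hle : ∀ x ∈ K, ∀ y ∈ K, l x = l y := by
    intro x hx y hy
    have h1 := hl x hx
    rw [← hl y hy] at h1
    exact mul_left_cancel₀ (by linarith) h1
  let f : ℝ × ℝ → ℝ := fun x => β * x.1 - α * x.2
  have hfc : Continuous f := by fun_prop
  have hpos : (0:ℝ) < α * α + β * β := by
    have : (0:ℤ) < α * α + β * β := by
      by_contra hcon
      apply hαβ
      constructor <;> nlinarith [mul_self_nonneg α, mul_self_nonneg β]
    exact_mod_cast this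
  have hinj : ∀ x y : ℝ × ℝ, l x = l y → f x = f y → x = y := by
    intro x y h1 h2
    simp only [l, f] at h1 h2
    ext
    · apply mul_left_cancel₀ hpos.ne'
      linear_combination (α:ℝ) * h1 + β * h2
    · apply mul_left_cancel₀ hpos.ne'
      linear_combination (β:ℝ) * h1 - α * h2
  obtain ⟨q, hq, hqm⟩ := h.hcomp.exists_isMaxOn ⟨p0, hp0⟩ hfc.continuousOn
  obtain ⟨p, hp, hpm⟩ := h.hcomp.exists_isMinOn ⟨p0, hp0⟩ hfc.continuousOn
  rw [isMaxOn_iff] at hqm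
  rw [isMinOn_iff] at hpm
  have hlin : ∀ θ : ℝ, l (AffineMap.lineMap p q θ) = l p := by
    intro θ
    have := hle p hp q hq
    simp only [AffineMap.lineMap_apply, l] at *
    simp
    linear_combination -θ * this
  have hflin : ∀ θ : ℝ, f (AffineMap.lineMap p q θ) = f p + θ * (f q - f p) := by
    intro θ
    simp only [AffineMap.lineMap_apply, f]
    simp
    ring
  refine ⟨p, q, Subset.antisymm ?_ ?_⟩
  · intro x hx
    rw [segment_eq_image_lineMap]
    have b1 := hpm x hx
    have b2 := hqm x hx
    rcases eq_or_lt_of_le (b1.trans b2) with hpq | hpq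
    · refine ⟨0, by simp, ?_⟩
      apply hinj
      · rw [hlin]; exact hle p hp x hx
      · rw [hflin]; linarith
    · refine ⟨(f x - f p) / (f q - f p), ⟨?_, ?_⟩, ?_⟩
      · apply div_nonneg <;> linarith
      · rw [div_le_one (by linarith)]; linarith
      · apply hinj
        · rw [hlin]; exact hle p hp x hx
        · rw [hflin, div_mul_cancel₀ _ (by linarith)]; ring
  · rw [segment_eq_image_lineMap]
    rintro _ ⟨θ, hθ, rfl⟩
    have hpq : f p ≤ f q := hqm p hp
    obtain ⟨x, hx, e⟩ := h.hconn.intermediate_value hp hq hfc.continuousOn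
      (show f (AffineMap.lineMap p q θ) ∈ Icc (f p) (f q) by
        rw [hflin]
        constructor
        · nlinarith [hθ.1]
        · nlinarith [hθ.2])
    have : AffineMap.lineMap p q θ = x := by
      apply hinj
      · rw [hlin]; exact hle p hp x hx
      · exact e.symm
    rwa [this]

end FS

lemma fin3 (S : Set (ℝ × ℝ)) (p q r : ℝ × ℝ) (hS : ∀ x, x ∈ S ↔ x = p ∨ x = q ∨ x = r)
    (h : p ≠ q ∧ p ≠ r ∧ q ≠ r) :
    S.Finite ∧ (Nat.card S = 3 ∨ Nat.card S = 4 ∨ Nat.card S = 6) := by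
  have : S = {p, q, r} := by ext x; simp [hS]
  subst this
  refine ⟨by simp, Or.inl ?_⟩
  rw [Nat.card_coe_set_eq, Set.ncard_eq_three]
  exact ⟨p, q, r, h.1, h.2.1, h.2.2, rfl⟩

lemma fin4 (S : Set (ℝ × ℝ)) (p q r s : ℝ × ℝ) (hS : ∀ x, x ∈ S ↔ x = p ∨ x = q ∨ x = r ∨ x = s)
    (h : p ≠ q ∧ p ≠ r ∧ p ≠ s ∧ q ≠ r ∧ q ≠ s ∧ r ≠ s) :
    S.Finite ∧ (Nat.card S = 3 ∨ Nat.card S = 4 ∨ Nat.card S = 6) := by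
  have : S = {p, q, r, s} := by ext x; simp [hS]
  subst this
  refine ⟨by simp, Or.inr (Or.inl ?_)⟩
  rw [Nat.card_coe_set_eq, Set.ncard_insert_of_notMem (by simp; tauto),
    Set.ncard_insert_of_notMem (by simp; tauto), Set.ncard_pair (by tauto)]

lemma fin6 (S : Set (ℝ × ℝ)) (p q r s t u : ℝ × ℝ)
    (hS : ∀ x, x ∈ S ↔ x = p ∨ x = q ∨ x = r ∨ x = s ∨ x = t ∨ x = u)
    (h : p ∉ ({q, r, s, t, u} : Set (ℝ × ℝ)) ∧ q ∉ ({r, s, t, u} : Set (ℝ × ℝ)) ∧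
      r ∉ ({s, t, u} : Set (ℝ × ℝ)) ∧ s ∉ ({t, u} : Set (ℝ × ℝ)) ∧ t ≠ u) :
    S.Finite ∧ (Nat.card S = 3 ∨ Nat.card S = 4 ∨ Nat.card S = 6) := by
  have : S = {p, q, r, s, t, u} := by ext x; simp [hS]
  subst this
  refine ⟨by simp, Or.inr (Or.inr ?_)⟩
  rw [Nat.card_coe_set_eq, Set.ncard_insert_of_notMem h.1,
    Set.ncard_insert_of_notMem h.2.1, Set.ncard_insert_of_notMem h.2.2.1,
    Set.ncard_insert_of_notMem h.2.2.2.1, Set.ncard_pair h.2.2.2.2]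

end

section
variable {n : ℕ} {D : Set (ℤ × ℤ)} {K : Set (ℝ × ℝ)}

/-- The counting step. -/
lemma count_points (S : Set (ℝ × ℝ)) (a b : ℝ) (H V P Q c00 c10 c01 c11 : Prop)
    (hS : ∀ x, x ∈ S ↔ (H ∧ (x = (1, a) ∨ x = (0, a))) ∨ (V ∧ (x = (b, 1) ∨ x = (b, 0))) ∨
      (P ∧ (x = (0, 0) ∨ x = (1, 1))) ∨ (Q ∧ (x = (1, 0) ∨ x = (0, 1))))
    (hH1 : H → c11 → c01 → a = 1) (hH0 : H → c10 → c00 → a = 0)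
    (hHa0 : H → a = 0 → c10 ∧ c00) (hHa1 : H → a = 1 → c11 ∧ c01)
    (hV1 : V → c11 → c10 → b = 1) (hV0 : V → c01 → c00 → b = 0)
    (hVb0 : V → b = 0 → c01 ∧ c00) (hVb1 : V → b = 1 → c11 ∧ c10)
    (hP : P → c00 ∧ c11) (hQ : Q → c10 ∧ c01)
    (n1 : V ∨ P ∨ Q) (n2 : H ∨ P ∨ Q) (n3 : H ∨ V ∨ Q) (n4 : H ∨ V ∨ P) :
    S.Finite ∧ (Nat.card S = 3 ∨ Nat.card S = 4 ∨ Nat.card S = 6) := by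
  have h01 : (0:ℝ) ≠ 1 := zero_ne_one
  have hHP : H → P → Q → False := by
    intro h p q
    have := hH1 h (hP p).2 (hQ q).2
    have := hH0 h (hQ q).1 (hP p).1
    simp_all
  have hVP : V → P → Q → False := by
    intro h p q
    have := hV1 h (hP p).2 (hQ q).1
    have := hV0 h (hQ q).2 (hP p).1
    simp_all
  by_cases h : H
  · by_cases v : V
    · by_cases p : P
      · have q : ¬ Q := fun q => hHP h p q
        by_cases a0 : a = 0
        · have b1 : b = 1 := hV1 v (hP p).2 (hHa0 h a0).1
          exact fin3 S (1, 0) (0, 0) (1, 1) (by intro x; rw [hS]; clear hS; grind) (by simp)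
        by_cases a1 : a = 1
        · have b0 : b = 0 := hV0 v (hHa1 h a1).2 (hP p).1
          exact fin3 S (1, 1) (0, 1) (0, 0) (by intro x; rw [hS]; clear hS; grind) (by simp)
        have b0 : b ≠ 0 := fun b0 => a1 (hH1 h (hP p).2 (hVb0 v b0).1)
        have b1 : b ≠ 1 := fun b1 => a0 (hH0 h (hVb1 v b1).2 (hP p).1)
        exact fin6 S (1, a) (0, a) (b, 1) (b, 0) (0, 0) (1, 1)
          (by intro x; rw [hS]; clear hS; grind) (by simp; grind)
      by_cases q : Q
      · by_cases a0 : a = 0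
        · have b0 : b = 0 := hV0 v (hQ q).2 (hHa0 h a0).2
          exact fin3 S (1, 0) (0, 0) (0, 1) (by intro x; rw [hS]; clear hS; grind) (by simp)
        by_cases a1 : a = 1
        · have b1 : b = 1 := hV1 v (hHa1 h a1).1 (hQ q).1
          exact fin3 S (1, 1) (0, 1) (1, 0) (by intro x; rw [hS]; clear hS; grind) (by simp)
        have b0 : b ≠ 0 := fun b0 => a0 (hH0 h (hQ q).1 (hVb0 v b0).2)
        have b1 : b ≠ 1 := fun b1 => a1 (hH1 h (hVb1 v b1).1 (hQ q).2)
        exact fin6 S (1, a) (0, a) (b, 1) (b, 0) (1, 0) (0, 1)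
          (by intro x; rw [hS]; clear hS; grind) (by simp; grind)
      by_cases a0 : a = 0
      · by_cases b0 : b = 0
        · exact fin3 S (1, 0) (0, 0) (0, 1) (by intro x; rw [hS]; clear hS; grind) (by simp)
        by_cases b1 : b = 1
        · exact fin3 S (1, 0) (0, 0) (1, 1) (by intro x; rw [hS]; clear hS; grind) (by simp)
        exact fin4 S (1, a) (0, a) (b, 1) (b, 0) (by intro x; rw [hS]; clear hS; grind) (by simp; grind)
      by_cases a1 : a = 1
      · by_cases b0 : b = 0
        · exact fin3 S (1, 1) (0, 1) (0, 0) (by intro x; rw [hS]; clear hS; grind) (by simp)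
        by_cases b1 : b = 1
        · exact fin3 S (1, 1) (0, 1) (1, 0) (by intro x; rw [hS]; clear hS; grind) (by simp)
        exact fin4 S (1, a) (0, a) (b, 1) (b, 0) (by intro x; rw [hS]; clear hS; grind) (by simp; grind)
      exact fin4 S (1, a) (0, a) (b, 1) (b, 0) (by intro x; rw [hS]; clear hS; grind) (by simp; grind)
    · by_cases p : P
      · have q : ¬ Q := fun q => hHP h p q
        by_cases a0 : a = 0
        · exact fin3 S (1, 0) (0, 0) (1, 1) (by intro x; rw [hS]; clear hS; grind) (by simp)
        by_cases a1 : a = 1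
        · exact fin3 S (1, 1) (0, 1) (0, 0) (by intro x; rw [hS]; clear hS; grind) (by simp)
        exact fin4 S (1, a) (0, a) (0, 0) (1, 1) (by intro x; rw [hS]; clear hS; grind) (by simp; grind)
      have q : Q := by grind
      by_cases a0 : a = 0
      · exact fin3 S (1, 0) (0, 0) (0, 1) (by intro x; rw [hS]; clear hS; grind) (by simp)
      by_cases a1 : a = 1
      · exact fin3 S (1, 1) (0, 1) (1, 0) (by intro x; rw [hS]; clear hS; grind) (by simp)
      exact fin4 S (1, a) (0, a) (1, 0) (0, 1) (by intro x; rw [hS]; clear hS; grind) (by simp; grind)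
  · by_cases v : V
    · by_cases p : P
      · have q : ¬ Q := fun q => hVP v p q
        by_cases b0 : b = 0
        · exact fin3 S (0, 1) (0, 0) (1, 1) (by intro x; rw [hS]; clear hS; grind) (by simp)
        by_cases b1 : b = 1
        · exact fin3 S (1, 1) (1, 0) (0, 0) (by intro x; rw [hS]; clear hS; grind) (by simp)
        exact fin4 S (b, 1) (b, 0) (0, 0) (1, 1) (by intro x; rw [hS]; clear hS; grind) (by simp; grind)
      have q : Q := by grind
      by_cases b0 : b = 0
      · exact fin3 S (0, 1) (0, 0) (1, 0) (by intro x; rw [hS]; clear hS; grind) (by simp)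
      by_cases b1 : b = 1
      · exact fin3 S (1, 1) (1, 0) (0, 1) (by intro x; rw [hS]; clear hS; grind) (by simp)
      exact fin4 S (b, 1) (b, 0) (1, 0) (0, 1) (by intro x; rw [hS]; clear hS; grind) (by simp; grind)
    · have p : P := by grind
      have q : Q := by grind
      exact fin4 S (0, 0) (1, 1) (1, 0) (0, 1) (by intro x; rw [hS]; clear hS; grind) (by simp)

/-- The contact predicate: the pieces at relative position `e` meet. -/
def Contact (n : ℕ) (D : Set (ℤ × ℤ)) (K : Set (ℝ × ℝ)) (e : ℤ × ℤ) : Prop :=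
  Reach n D e ∧ ∃ x ∈ K, (x.1 - e.1, x.2 - e.2) ∈ K

namespace FS

lemma con_symm (e : ℤ × ℤ) (h : Contact n D K e) : Contact n D K (-e) := by
  obtain ⟨hr, x, hx, hy⟩ := h
  refine ⟨FS.reach_symm hr, _, hy, ?_⟩
  simpa using hx

lemma con_cases (h : FS n D K) (e : ℤ × ℤ) (he : Contact n D K e) :
    e = (1, 0) ∨ e = (-1, 0) ∨ e = (0, 1) ∨ e = (0, -1) ∨ e = (1, 1) ∨ e = (-1, -1) ∨
      e = (1, -1) ∨ e = (-1, 1) := by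
  obtain ⟨⟨h0, -⟩, x, hx, hy⟩ := he
  obtain ⟨e1, e2⟩ := e
  obtain ⟨⟨a1, a2⟩, a3, a4⟩ := h.unit _ hx
  obtain ⟨⟨b1, b2⟩, b3, b4⟩ := h.unit _ hy
  simp only at *
  have c1 : (e1:ℝ) ≤ 1 := by linarith
  have c2 : (-1:ℝ) ≤ e1 := by linarith
  have c3 : (e2:ℝ) ≤ 1 := by linarith
  have c4 : (-1:ℝ) ≤ e2 := by linarith
  have d1 : e1 ≤ 1 := by exact_mod_cast c1
  have d2 : -1 ≤ e1 := by exact_mod_cast c2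
  have d3 : e2 ≤ 1 := by exact_mod_cast c3
  have d4 : -1 ≤ e2 := by exact_mod_cast c4
  interval_cases e1 <;> interval_cases e2 <;> simp_all

lemma main (h : FS n D K) (hseg : ¬ ∃ a b : ℝ × ℝ, K = segment ℝ a b) :
    (ssBoundary n D K).Finite ∧
      (Nat.card (ssBoundary n D K) = 3 ∨ Nat.card (ssBoundary n D K) = 4 ∨
        Nat.card (ssBoundary n D K) = 6) := by
  have hbd : ∀ x, x ∈ ssBoundary n D K ↔ ∃ e : ℤ × ℤ, Reach n D e ∧ x ∈ K ∧
      (x.1 - e.1, x.2 - e.2) ∈ K := h.mem_boundary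
  have hHa : ∃ a, Contact n D K (1, 0) → (1, a) ∈ K ∧ (0, a) ∈ K := by
    by_cases hc : Contact n D K (1, 0)
    · obtain ⟨hr, ⟨x, y⟩, hx, hy⟩ := hc
      have u := h.unit _ hx
      have v := h.unit _ hy
      simp only [Int.cast_one, Int.cast_zero, sub_zero] at *
      have : x = 1 := by linarith
      subst this
      exact ⟨y, fun _ => ⟨hx, by simpa using hy⟩⟩
    · exact ⟨0, fun q => (hc q).elim⟩
  have hVb : ∃ b, Contact n D K (0, 1) → (b, 1) ∈ K ∧ (b, 0) ∈ K := by
    by_cases hc : Contact n D K (0, 1)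
    · obtain ⟨hr, ⟨x, y⟩, hx, hy⟩ := hc
      have u := h.unit _ hx
      have v := h.unit _ hy
      simp only [Int.cast_one, Int.cast_zero, sub_zero] at *
      have : y = 1 := by linarith
      subst this
      exact ⟨x, fun _ => ⟨hx, by simpa using hy⟩⟩
    · exact ⟨0, fun q => (hc q).elim⟩
  obtain ⟨a, ha⟩ := hHa
  obtain ⟨b, hb⟩ := hVb
  have hP : Contact n D K (1, 1) → (0, 0) ∈ K ∧ (1, 1) ∈ K := by
    rintro ⟨hr, ⟨x, y⟩, hx, hy⟩
    have u := h.unit _ hx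
    have v := h.unit _ hy
    simp only [Int.cast_one] at *
    have : x = 1 := by linarith
    have : y = 1 := by linarith
    subst x y
    exact ⟨by simpa using hy, hx⟩
  have hQ : Contact n D K (1, -1) → (1, 0) ∈ K ∧ (0, 1) ∈ K := by
    rintro ⟨hr, ⟨x, y⟩, hx, hy⟩
    have u := h.unit _ hx
    have v := h.unit _ hy
    simp only [Int.cast_one, Int.cast_neg] at *
    have : x = 1 := by linarith
    have : y = 0 := by linarith
    subst x y
    exact ⟨hx, by simpa using hy⟩
  have hdir : ∀ α β : ℤ, ¬(α = 0 ∧ β = 0) →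
      ((Contact n D K (1, 0) → α = 0) ∧ (Contact n D K (0, 1) → β = 0) ∧
        (Contact n D K (1, 1) → α + β = 0) ∧ (Contact n D K (1, -1) → α - β = 0)) → False := by
    rintro α β h0 ⟨k1, k2, k3, k4⟩
    refine hseg (h.seg_of_dir α β h0 ?_)
    intro e hr hx
    have hc : Contact n D K e := ⟨hr, hx⟩
    have hc' := con_symm e hc
    rcases h.con_cases e hc with r | r | r | r | r | r | r | r <;> subst r <;>
      simp only [Prod.neg_mk, neg_neg, neg_zero] at hc' hc ⊢
    · have := k1 hc; linarith
    · have := k1 hc'; linarith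
    · have := k2 hc; linarith
    · have := k2 hc'; linarith
    · have := k3 hc; linarith
    · have := k3 hc'; linarith
    · have := k4 hc; linarith
    · have := k4 hc'; linarith
  have uH : Contact n D K (1, 0) → ∀ t, (1, t) ∈ K → (0, t) ∈ K → a = t := fun hc t h1 h2 =>
    h.uniq_h' hc.1 a t (ha hc).1 (ha hc).2 h1 h2
  have uV : Contact n D K (0, 1) → ∀ t, (t, 1) ∈ K → (t, 0) ∈ K → b = t := fun hc t h1 h2 =>
    h.uniq_v' hc.1 b t (hb hc).1 (hb hc).2 h1 h2
  refine count_points _ a b (Contact n D K (1, 0)) (Contact n D K (0, 1)) (Contact n D K (1, 1))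
    (Contact n D K (1, -1)) ((0, 0) ∈ K) ((1, 0) ∈ K) ((0, 1) ∈ K) ((1, 1) ∈ K) ?_
    (fun c h1 h2 => uH c 1 h1 h2) (fun c h1 h2 => uH c 0 h1 h2)
    (fun c e => by subst e; exact ha c) (fun c e => by subst e; exact ha c)
    (fun c h1 h2 => uV c 1 h1 h2) (fun c h1 h2 => uV c 0 h1 h2)
    (fun c e => by subst e; exact hb c) (fun c e => by subst e; exact hb c)
    hP hQ ?_ ?_ ?_ ?_
  · intro x
    rw [hbd]
    constructor
    · rintro ⟨e, hr, hx, hy⟩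
      have hc : Contact n D K e := ⟨hr, x, hx, hy⟩
      have hc' := con_symm e hc
      obtain ⟨x, y⟩ := x
      have u := h.unit _ hx
      have v := h.unit _ hy
      rcases h.con_cases e hc with r | r | r | r | r | r | r | r <;> subst r <;>
        simp only [Prod.neg_mk, neg_neg, neg_zero, Int.cast_one, Int.cast_neg, Int.cast_zero,
          sub_zero] at hc' hc hx hy u v ⊢
      · obtain rfl : x = 1 := by linarith
        have := uH hc y hx (by simpa using hy)
        subst this
        exact Or.inl ⟨hc, Or.inl rfl⟩
      · obtain rfl : x = 0 := by linarith
        have := uH hc' y (by simpa using hy) hx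
        subst this
        exact Or.inl ⟨hc', Or.inr rfl⟩
      · obtain rfl : y = 1 := by linarith
        have := uV hc x hx (by simpa using hy)
        subst this
        exact Or.inr (Or.inl ⟨hc, Or.inl rfl⟩)
      · obtain rfl : y = 0 := by linarith
        have := uV hc' x (by simpa using hy) hx
        subst this
        exact Or.inr (Or.inl ⟨hc', Or.inr rfl⟩)
      · obtain rfl : x = 1 := by linarith
        obtain rfl : y = 1 := by linarith
        exact Or.inr (Or.inr (Or.inl ⟨hc, Or.inr rfl⟩))
      · obtain rfl : x = 0 := by linarith
        obtain rfl : y = 0 := by linarith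
        exact Or.inr (Or.inr (Or.inl ⟨hc', Or.inl rfl⟩))
      · obtain rfl : x = 1 := by linarith
        obtain rfl : y = 0 := by linarith
        exact Or.inr (Or.inr (Or.inr ⟨hc, Or.inl rfl⟩))
      · obtain rfl : x = 0 := by linarith
        obtain rfl : y = 1 := by linarith
        exact Or.inr (Or.inr (Or.inr ⟨hc', Or.inr rfl⟩))
    · rintro (⟨c, rfl | rfl⟩ | ⟨c, rfl | rfl⟩ | ⟨c, rfl | rfl⟩ | ⟨c, rfl | rfl⟩)
      · exact ⟨_, c.1, (ha c).1, by simpa using (ha c).2⟩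
      · exact ⟨_, (con_symm _ c).1, (ha c).2, by simpa using (ha c).1⟩
      · exact ⟨_, c.1, (hb c).1, by simpa using (hb c).2⟩
      · exact ⟨_, (con_symm _ c).1, (hb c).2, by simpa using (hb c).1⟩
      · exact ⟨_, (con_symm _ c).1, (hP c).1, by simpa using (hP c).2⟩
      · exact ⟨_, c.1, (hP c).2, by simpa using (hP c).1⟩
      · exact ⟨_, c.1, (hQ c).1, by simpa using (hQ c).2⟩
      · exact ⟨_, (con_symm _ c).1, (hQ c).2, by simpa using (hQ c).1⟩
  · by_contra hh
    exact hdir 0 1 (by simp) ⟨by simp, by tauto, by tauto, by tauto⟩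
  · by_contra hh
    exact hdir 1 0 (by simp) ⟨by tauto, by simp, by tauto, by tauto⟩
  · by_contra hh
    exact hdir 1 (-1) (by simp) ⟨by tauto, by tauto, by simp, by tauto⟩
  · by_contra hh
    exact hdir 1 1 (by simp) ⟨by tauto, by tauto, by tauto, by simp⟩

lemma of_hyp (hK : IsFractalSquare n D K) (hden : IsDendrite K) : FS n D K := by
  obtain ⟨hn, hD, -, hcard, hne, hcomp, heq⟩ := hK
  obtain ⟨-, -, hconn, -, hnc⟩ := hden
  refine ⟨hn, fun d hd => ?_, hne, hcomp, hconn.isPreconnected, fun x => ?_,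
    noCirc_of_no_circle K hnc, ?_⟩
  · have := hD hd
    exact ⟨⟨this.1.1, this.2.1⟩, this.1.2, this.2.2⟩
  · constructor
    · intro hx
      rw [heq] at hx
      simpa using hx
    · rintro ⟨d, hd, y, hy, rfl⟩
      rw [heq]
      exact mem_biUnion hd ⟨y, hy, rfl⟩
  · by_contra hall
    push Not at hall
    have hDeq : D = ↑(Finset.Icc (0:ℤ) (n - 1) ×ˢ Finset.Icc (0:ℤ) (n - 1)) := by
      ext d
      simp only [Finset.coe_product, Finset.coe_Icc, mem_prod, mem_Icc]
      constructor
      · intro hd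
        have := hD hd
        exact ⟨⟨this.1.1, this.2.1⟩, this.1.2, this.2.2⟩
      · rintro ⟨h1, h2⟩
        exact hall d h1 h2
    rw [hDeq, Nat.card_coe_set_eq, Set.ncard_coe_finset, Finset.card_product] at hcard
    simp at hcard
    nlinarith

end FS

end

/-- If a fractal square `K` is a dendrite and is not a line segment,
then its self-similar boundary is finite, of cardinality 3, 4 or 6. -/
theorem fractalSquare_dendrite_ssBoundary_card
    (n : ℕ) (D : Set (ℤ × ℤ)) (K : Set (ℝ × ℝ))
    (hK : IsFractalSquare n D K) (hden : IsDendrite K)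
    (hseg : ¬ ∃ a b : ℝ × ℝ, K = segment ℝ a b) :
    (ssBoundary n D K).Finite ∧
      (Nat.card (ssBoundary n D K) = 3 ∨ Nat.card (ssBoundary n D K) = 4 ∨
        Nat.card (ssBoundary n D K) = 6) := by
  exact (FS.of_hyp hK hden).main hseg
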